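/- arXiv:math/9910035 — 2 statements merged into one kernel-verified Lean document; each statement's English description precedes it below -/
import Mathlib

section
/- Let K be a field, q ∈ K nonzero, and n > t positive integers. The map j*_q : O_q(V°) → O_q(M_n^{≤t,°}) ⊗ O_q(GL_t), given on pure tensors by j*_q(a ⊗ b) = Σ b_0 S^{−1}(b_{−1}) a_0 ⊗ S(a_1) b_{−2} (products in the first factor taken in O_q(M_n^{≤t,°}) via the lower-left-corner embeddings), is a morphism of left O_q(GL_t)-comodules from (O_q(V°), γ°*_q) to (O_q(M_n^{≤t,°}) ⊗ O_q(GL_t), ξ*_q); that is, ξ*_q ∘ j*_q = (id ⊗ j*_q) ∘ γ°*_q. -/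
open scoped TensorProduct

noncomputable section

/-- The four defining relations of the quantized coordinate ring `O_q(M_{u,v})`, as a relation
on the free algebra on generators `X_{ij}`, `(i,j) ∈ Fin u × Fin v`. -/
inductive QMRel (K : Type) [Field K] (q : K) (u v : ℕ) :
    FreeAlgebra K (Fin u × Fin v) → FreeAlgebra K (Fin u × Fin v) → Prop
  | row {i : Fin u} {j k : Fin v} (h : j < k) :
      QMRel K q u v (FreeAlgebra.ι K (i, j) * FreeAlgebra.ι K (i, k))
        (q • (FreeAlgebra.ι K (i, k) * FreeAlgebra.ι K (i, j)))
  | col {i k : Fin u} {j : Fin v} (h : i < k) :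
      QMRel K q u v (FreeAlgebra.ι K (i, j) * FreeAlgebra.ι K (k, j))
        (q • (FreeAlgebra.ι K (k, j) * FreeAlgebra.ι K (i, j)))
  | comm {i k : Fin u} {j l : Fin v} (h1 : i < k) (h2 : l < j) :
      QMRel K q u v (FreeAlgebra.ι K (i, j) * FreeAlgebra.ι K (k, l))
        (FreeAlgebra.ι K (k, l) * FreeAlgebra.ι K (i, j))
  | quantum {i k : Fin u} {j l : Fin v} (h1 : i < k) (h2 : j < l) :
      QMRel K q u v (FreeAlgebra.ι K (i, j) * FreeAlgebra.ι K (k, l))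
        (FreeAlgebra.ι K (k, l) * FreeAlgebra.ι K (i, j) +
          (q - q⁻¹) • (FreeAlgebra.ι K (i, l) * FreeAlgebra.ι K (k, j)))

/-- The quantized coordinate ring `O_q(M_{u,v})` of `u × v` matrices. -/
abbrev OqM (K : Type) [Field K] (q : K) (u v : ℕ) :=
  RingQuot (QMRel K q u v)

/-- The canonical generators `X_{ij}` of `O_q(M_{u,v})`. -/
def Xg (K : Type) [Field K] (q : K) {u v : ℕ} (i : Fin u) (j : Fin v) : OqM K q u v :=
  RingQuot.mkAlgHom K (QMRel K q u v) (FreeAlgebra.ι K (i, j))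

/-- The number of inversions (the length) of a permutation of `Fin l`. -/
def invCount {l : ℕ} (σ : Equiv.Perm (Fin l)) : ℕ :=
  (Finset.univ.filter fun p : Fin l × Fin l => p.1 < p.2 ∧ σ p.2 < σ p.1).card

/-- The `l × l` quantum minor of `O_q(M_{u,v})` with rows `R 0, …, R (l-1)` and columns
`C 0, …, C (l-1)`:  `[R|C] = Σ_σ (-q)^{ℓ(σ)} X_{R 0, C (σ 0)} ⋯ X_{R (l-1), C (σ (l-1))}`. -/
def qMinor (K : Type) [Field K] (q : K) {u v l : ℕ} (R : Fin l → Fin u) (C : Fin l → Fin v) :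
    OqM K q u v :=
  ∑ σ : Equiv.Perm (Fin l),
    ((-q) ^ invCount σ) • (List.ofFn fun i : Fin l => Xg K q (R i) (C (σ i))).prod

/-- The relations killing all `(t+1) × (t+1)` quantum minors of `O_q(M_{m,n})`. -/
inductive DetRel (K : Type) [Field K] (q : K) (m n t : ℕ) :
    OqM K q m n → OqM K q m n → Prop
  | minor (R : Fin (t + 1) → Fin m) (C : Fin (t + 1) → Fin n)
      (hR : StrictMono R) (hC : StrictMono C) :
      DetRel K q m n t (qMinor K q R C) 0

/-- `O_q(M_{m,n}^{≤ t}) = O_q(M_{m,n}) / I_{t+1}`, the quotient by the ideal generated by all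
`(t+1) × (t+1)` quantum minors. -/
abbrev OqMle (K : Type) [Field K] (q : K) (m n t : ℕ) :=
  RingQuot (DetRel K q m n t)

/-- The quotient map `O_q(M_{m,n}) → O_q(M_{m,n}^{≤ t})`. -/
def mkle (K : Type) [Field K] (q : K) (m n t : ℕ) :
    OqM K q m n →ₐ[K] OqMle K q m n t :=
  RingQuot.mkAlgHom K (DetRel K q m n t)

/-- The two-sided ideal of a `K`-algebra `R` generated by a subset `S`, as a set. -/
def tsSpan (K : Type) [Field K] (R : Type) [Ring R] [Algebra K R] (S : Set R) : Set R :=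
  (Submodule.span K {x : R | ∃ a b : R, ∃ s ∈ S, x = a * s * b} : Submodule K R)

/-- The left `H`-comodule structure map `γ* : A ⊗ B → H ⊗ (A ⊗ B)` given on pure tensors by
`γ*(a ⊗ b) = Σ S(a₁) b₋₁ ⊗ a₀ ⊗ b₀`, built from a right coaction `ρ* : A → A ⊗ H`, a left
coaction `λ* : B → H ⊗ B`, and the antipode `S` of `H`. -/
def gammaMap (K A B H : Type) [Field K] [Ring A] [Algebra K A] [Ring B] [Algebra K B]
    [Ring H] [HopfAlgebra K H]
    (ρ : A →ₐ[K] A ⊗[K] H) (lam : B →ₐ[K] H ⊗[K] B) :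
    (A ⊗[K] B) →ₗ[K] H ⊗[K] (A ⊗[K] B) :=
  (TensorProduct.map
      ((LinearMap.mul' K H).comp
        (TensorProduct.map (HopfAlgebra.antipode (R := K)) LinearMap.id))
      LinearMap.id)
    ∘ₗ (TensorProduct.tensorTensorTensorComm K H A H B).toLinearMap
    ∘ₗ (TensorProduct.map (TensorProduct.comm K A H).toLinearMap LinearMap.id)
    ∘ₗ (TensorProduct.map ρ.toLinearMap lam.toLinearMap)

/-- The quantum determinant `d_T` of `O_q(M_t)`. -/
def qdet (K : Type) [Field K] (q : K) (t : ℕ) : OqM K q t t :=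
  qMinor K q (id : Fin t → Fin t) (id : Fin t → Fin t)

/-- The rows `{n-t+1, …, n}` (the lowest `t` rows). -/
def rowTop (n t : ℕ) (h : t ≤ n) : Fin t → Fin n :=
  fun i => ⟨n - t + i.1, by have := i.2; omega⟩

/-- The columns `{1, …, t}` (the leftmost `t` columns). -/
def colLeft (n t : ℕ) (h : t ≤ n) : Fin t → Fin n :=
  fun i => ⟨i.1, by have := i.2; omega⟩

/-- `d_Y = [n,…,n-t+1 | 1,…,t] ∈ O_q(M_{n,t})`. -/
def dY (K : Type) [Field K] (q : K) (n t : ℕ) (h : t ≤ n) : OqM K q n t :=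
  qMinor K q (rowTop n t h) (id : Fin t → Fin t)

/-- `d_Z = [t,…,1 | 1,…,t] ∈ O_q(M_{t,n})`. -/
def dZ (K : Type) [Field K] (q : K) (n t : ℕ) (h : t ≤ n) : OqM K q t n :=
  qMinor K q (id : Fin t → Fin t) (colLeft n t h)

/-- `d_X = [n,…,n-t+1 | 1,…,t] ∈ O_q(M_n)`. -/
def dX (K : Type) [Field K] (q : K) (n t : ℕ) (h : t ≤ n) : OqM K q n n :=
  qMinor K q (rowTop n t h) (colLeft n t h)

/-- `d_x = d_X + I_{t+1} ∈ O_q(M_n^{≤ t})`. -/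
def dx (K : Type) [Field K] (q : K) (n t : ℕ) (h : t ≤ n) : OqMle K q n n t :=
  mkle K q n n t (dX K q n t h)

/-- The left `H`-comodule structure map `ξ* : M ⊗ H → H ⊗ (M ⊗ H)`, `x ⊗ h ↦ Σ h₁ ⊗ x ⊗ h₂`:
the tensor product of the trivial left coaction on `M` with the coaction of `H` on itself by
comultiplication. -/
def xiMap (K M H : Type) [Field K] [AddCommGroup M] [Module K M] [Ring H] [HopfAlgebra K H] :
    (M ⊗[K] H) →ₗ[K] H ⊗[K] (M ⊗[K] H) :=
  (TensorProduct.leftComm K M H H).toLinearMap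
    ∘ₗ (TensorProduct.map LinearMap.id (Coalgebra.comul (R := K)))

/-- The map `j*_q : O_q(V°) → O_q(M_n^{≤t,°}) ⊗ O_q(GL_t)`, given on pure tensors by
`j*_q(a ⊗ b) = Σ b₀ S⁻¹(b₋₁) a₀ ⊗ S(a₁) b₋₂`, where `ρ°*_q(a) = Σ a₀ ⊗ a₁` and
`(Δ ⊗ id) λ°*_q(b) = Σ b₋₂ ⊗ b₋₁ ⊗ b₀`, the products in the first factor being taken in
`O_q(M_n^{≤t,°})` via the lower-left-corner embeddings `eA`, `eZ`, `eG`. -/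
def jMap (K G Ao Zo Xo : Type) [Field K] [Ring G] [HopfAlgebra K G]
    [Ring Ao] [Algebra K Ao] [Ring Zo] [Algebra K Zo] [Ring Xo] [Algebra K Xo]
    (ρo : Ao →ₐ[K] Ao ⊗[K] G) (lamo : Zo →ₐ[K] G ⊗[K] Zo)
    (eA : Ao →ₐ[K] Xo) (eZ : Zo →ₐ[K] Xo) (eG : G →ₐ[K] Xo) (Sinv : G →ₗ[K] G) :
    (Ao ⊗[K] Zo) →ₗ[K] Xo ⊗[K] G :=
  -- multiply out the first factor `(b₀ ⊗ b₋₁) ⊗ a₀ ↦ eZ b₀ * eG (S⁻¹ b₋₁) * eA a₀` …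
  (TensorProduct.map
      ((LinearMap.mul' K Xo).comp
        (TensorProduct.map
          ((LinearMap.mul' K Xo).comp
            (TensorProduct.map eZ.toLinearMap (eG.toLinearMap ∘ₗ Sinv)))
          eA.toLinearMap))
      -- … and the second factor `a₁ ⊗ b₋₂ ↦ S(a₁) * b₋₂`
      ((LinearMap.mul' K G).comp
        (TensorProduct.map (HopfAlgebra.antipode (R := K)) LinearMap.id)))
    ∘ₗ (TensorProduct.comm K (G ⊗[K] G) ((Zo ⊗[K] G) ⊗[K] Ao)).toLinearMap
    ∘ₗ (TensorProduct.map (TensorProduct.comm K G G).toLinearMap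
          ((TensorProduct.comm K Ao (Zo ⊗[K] G)).toLinearMap
            ∘ₗ (TensorProduct.leftComm K Zo Ao G).toLinearMap
            ∘ₗ (TensorProduct.comm K (Ao ⊗[K] G) Zo).toLinearMap))
    ∘ₗ (TensorProduct.tensorTensorTensorComm K G (Ao ⊗[K] G) G Zo).toLinearMap
    ∘ₗ (TensorProduct.map (TensorProduct.leftComm K Ao G G).toLinearMap LinearMap.id)
    ∘ₗ (TensorProduct.tensorTensorTensorComm K Ao G (G ⊗[K] G) Zo).toLinearMap
    ∘ₗ (TensorProduct.map ρo.toLinearMap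
          ((TensorProduct.map (Coalgebra.comul (R := K)) LinearMap.id) ∘ₗ lamo.toLinearMap))

open Coalgebra in
/-- The antipode of a Hopf algebra is an anti-homomorphism of coalgebras. -/
theorem HopfAlgebra.comul_antipode {R H : Type*} [CommSemiring R] [Semiring H] [HopfAlgebra R H]
    (h : H) :
    comul (R := R) (antipode R h) =
      TensorProduct.comm R H H (TensorProduct.map (antipode R) (antipode R) (comul h)) := by
  let S : H →ₗ[R] H := antipode R
  let F : H →ₗ[R] H ⊗[R] H :=
    (TensorProduct.comm R H H).toLinearMap ∘ₗ TensorProduct.map S S ∘ₗ comul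
  suffices hF : WithConv.toConv F * WithConv.toConv (comul (R := R) (A := H)) = 1 from
    (congr(($(left_inv_eq_right_inv hF LinearMap.comul_right_inv)).ofConv h)).symm
  let M : H ⊗[R] H →ₗ[R] H := LinearMap.mul' R H ∘ₗ TensorProduct.map S LinearMap.id
  have hM (a : H) : M (comul a) = algebraMap R H (counit a) :=
    mul_antipode_rTensor_comul_apply a
  -- `g (p ⊗ (r ⊗ (u ⊗ w))) = S(r) u ⊗ S(p) w`
  let g : H ⊗[R] (H ⊗[R] (H ⊗[R] H)) →ₗ[R] H ⊗[R] H :=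
    TensorProduct.map M M ∘ₗ (TensorProduct.leftComm R H (H ⊗[R] H) H).toLinearMap ∘ₗ
      TensorProduct.map LinearMap.id (TensorProduct.assoc R H H H).symm.toLinearMap
  have key (x y : H) : g (x ⊗ₜ TensorProduct.map LinearMap.id comul (comul (R := R) y)) =
      1 ⊗ₜ M (x ⊗ₜ y) := by
    have h1 : TensorProduct.map LinearMap.id comul (comul (R := R) y) =
        TensorProduct.assoc R H H H (TensorProduct.map comul LinearMap.id (comul (R := R) y)) :=
      (Coalgebra.coassoc_apply y).symm
    have h2 (z : H ⊗[R] H) : g (x ⊗ₜ TensorProduct.assoc R H H H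
        (TensorProduct.map comul LinearMap.id z)) =
        1 ⊗ₜ M (x ⊗ₜ TensorProduct.lid R H (TensorProduct.map counit LinearMap.id z)) := by
      induction z with
      | zero => simp
      | add a b ha hb => simp only [map_add, ha, hb, TensorProduct.tmul_add]
      | tmul u w => simp [g, hM, Algebra.algebraMap_eq_smul_one, TensorProduct.smul_tmul]
    have h3 : TensorProduct.map counit LinearMap.id (comul (R := R) y) = (1 : R) ⊗ₜ y :=
      Coalgebra.rTensor_counit_comul y
    rw [h1, h2, h3, TensorProduct.lid_tmul, one_smul]
  have regroup (z : H ⊗[R] H) : LinearMap.mul' R (H ⊗[R] H) (TensorProduct.map F comul z) =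
      g (TensorProduct.map LinearMap.id (TensorProduct.map LinearMap.id comul)
        (TensorProduct.assoc R H H H (TensorProduct.map comul LinearMap.id z))) := by
    induction z with
    | zero => simp
    | add a b ha hb => simp only [map_add, ha, hb]
    | tmul x y =>
      simp only [TensorProduct.map_tmul, LinearMap.mul'_apply, LinearMap.id_coe, id_eq, F,
        LinearMap.comp_apply]
      generalize (comul x : H ⊗[R] H) = P
      induction P with
      | zero => simp
      | add a b ha hb => simp only [map_add, add_mul, TensorProduct.add_tmul, ha, hb]
      | tmul p r =>
        simp only [TensorProduct.map_tmul, TensorProduct.assoc_tmul, LinearMap.id_coe, id_eq]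
        generalize (comul y : H ⊗[R] H) = Q
        induction Q with
        | zero => simp
        | add a b ha hb => simp only [map_add, mul_add, TensorProduct.tmul_add, ha, hb]
        | tmul u w => simp [g, M]
  have collapse (z : H ⊗[R] H) :
      g (TensorProduct.map LinearMap.id (TensorProduct.map LinearMap.id comul)
        (TensorProduct.map LinearMap.id comul z)) = 1 ⊗ₜ M z := by
    induction z with
    | zero => simp
    | add a b ha hb => simp only [map_add, TensorProduct.tmul_add, ha, hb]
    | tmul x y => simpa using key x y
  ext a
  have h4 : TensorProduct.assoc R H H H (TensorProduct.map comul LinearMap.id (comul (R := R) a)) =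
      TensorProduct.map LinearMap.id comul (comul (R := R) a) := Coalgebra.coassoc_apply a
  rw [LinearMap.convMul_apply, LinearMap.convOne_apply]
  change LinearMap.mul' R (H ⊗[R] H) (TensorProduct.map F comul (comul a)) = _
  rw [regroup, h4, collapse, hM, Algebra.TensorProduct.algebraMap_apply']

/-- The generators `X_{ij}` determine an algebra homomorphism out of `O_q(M_{u,v})`. -/
theorem OqM.algHom_ext {K : Type} [Field K] {q : K} {u v : ℕ} {C : Type*} [Semiring C]
    [Algebra K C] {f g : OqM K q u v →ₐ[K] C}
    (h : ∀ i j, f (Xg K q i j) = g (Xg K q i j)) : f = g :=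
  RingQuot.ringQuot_ext' _ _ _ (FreeAlgebra.hom_ext (funext fun p => h p.1 p.2))

section Comodule

variable {K A B H X : Type} [Field K] [Ring A] [Algebra K A] [Ring B] [Algebra K B]
  [Ring H] [HopfAlgebra K H] [Ring X] [Algebra K X]

open Coalgebra HopfAlgebra

/-- The core of `jMap`: `((a ⊗ g) ⊗ (h ⊗ b)) ↦ Σ b S⁻¹(h₂) a ⊗ S(g) h₁`. -/
def jCore (eA : A →ₐ[K] X) (eB : B →ₐ[K] X) (eH : H →ₐ[K] X) (Sinv : H →ₗ[K] H) :
    (A ⊗[K] H) ⊗[K] (H ⊗[K] B) →ₗ[K] X ⊗[K] H :=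
  (TensorProduct.map
      ((LinearMap.mul' K X).comp
        (TensorProduct.map
          ((LinearMap.mul' K X).comp
            (TensorProduct.map eB.toLinearMap (eH.toLinearMap ∘ₗ Sinv)))
          eA.toLinearMap))
      ((LinearMap.mul' K H).comp
        (TensorProduct.map (HopfAlgebra.antipode (R := K)) LinearMap.id)))
    ∘ₗ (TensorProduct.comm K (H ⊗[K] H) ((B ⊗[K] H) ⊗[K] A)).toLinearMap
    ∘ₗ (TensorProduct.map (TensorProduct.comm K H H).toLinearMap
          ((TensorProduct.comm K A (B ⊗[K] H)).toLinearMap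
            ∘ₗ (TensorProduct.leftComm K B A H).toLinearMap
            ∘ₗ (TensorProduct.comm K (A ⊗[K] H) B).toLinearMap))
    ∘ₗ (TensorProduct.tensorTensorTensorComm K H (A ⊗[K] H) H B).toLinearMap
    ∘ₗ (TensorProduct.map (TensorProduct.leftComm K A H H).toLinearMap LinearMap.id)
    ∘ₗ (TensorProduct.tensorTensorTensorComm K A H (H ⊗[K] H) B).toLinearMap
    ∘ₗ (TensorProduct.map LinearMap.id (TensorProduct.map (comul (R := K)) LinearMap.id))

/-- `(h₁ ⊗ h₂) ↦ b S⁻¹(h₂) a ⊗ s h₁`. -/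
def jPure (eA : A →ₐ[K] X) (eB : B →ₐ[K] X) (eH : H →ₐ[K] X) (Sinv : H →ₗ[K] H)
    (a : A) (b : B) (s : H) : H ⊗[K] H →ₗ[K] X ⊗[K] H :=
  TensorProduct.map
      (LinearMap.mulRight K (eA a) ∘ₗ LinearMap.mulLeft K (eB b) ∘ₗ eH.toLinearMap ∘ₗ Sinv)
      (LinearMap.mulLeft K s)
    ∘ₗ (TensorProduct.comm K H H).toLinearMap

theorem jCore_tmul (eA : A →ₐ[K] X) (eB : B →ₐ[K] X) (eH : H →ₐ[K] X) (Sinv : H →ₗ[K] H)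
    (a : A) (g h : H) (b : B) :
    jCore eA eB eH Sinv ((a ⊗ₜ g) ⊗ₜ (h ⊗ₜ b)) =
      jPure eA eB eH Sinv a b (antipode K g) (comul h) := by
  simp only [jCore, LinearMap.comp_apply, TensorProduct.map_tmul, LinearMap.id_coe, id_eq]
  generalize (comul h : H ⊗[K] H) = P
  induction P with
  | zero => simp
  | add x y hx hy => simp only [map_add, TensorProduct.add_tmul, TensorProduct.tmul_add, hx, hy]
  | tmul x y => simp [jPure]

theorem jMap_eq_jCore (ρ : A →ₐ[K] A ⊗[K] H) (lam : B →ₐ[K] H ⊗[K] B)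
    (eA : A →ₐ[K] X) (eB : B →ₐ[K] X) (eH : H →ₐ[K] X) (Sinv : H →ₗ[K] H) (a : A) (b : B) :
    jMap K H A B X ρ lam eA eB eH Sinv (a ⊗ₜ b) = jCore eA eB eH Sinv (ρ a ⊗ₜ lam b) :=
  rfl

/-- `((a ⊗ g) ⊗ g') ⊗ (h ⊗ (h' ⊗ b)) ↦ S(g') h ⊗ jCore ((a ⊗ g) ⊗ (h' ⊗ b))`. -/
def antipodeMulCore (eA : A →ₐ[K] X) (eB : B →ₐ[K] X) (eH : H →ₐ[K] X) (Sinv : H →ₗ[K] H) :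
    ((A ⊗[K] H) ⊗[K] H) ⊗[K] (H ⊗[K] (H ⊗[K] B)) →ₗ[K] H ⊗[K] (X ⊗[K] H) :=
  TensorProduct.map (LinearMap.mul' K H ∘ₗ TensorProduct.map (antipode K) LinearMap.id)
      (jCore eA eB eH Sinv)
    ∘ₗ (TensorProduct.tensorTensorTensorComm K H (A ⊗[K] H) H (H ⊗[K] B)).toLinearMap
    ∘ₗ TensorProduct.map (TensorProduct.comm K (A ⊗[K] H) H).toLinearMap LinearMap.id

theorem map_jMap_gammaMap (ρ : A →ₐ[K] A ⊗[K] H) (lam : B →ₐ[K] H ⊗[K] B)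
    (eA : A →ₐ[K] X) (eB : B →ₐ[K] X) (eH : H →ₐ[K] X) (Sinv : H →ₗ[K] H) (a : A) (b : B) :
    TensorProduct.map LinearMap.id (jMap K H A B X ρ lam eA eB eH Sinv)
        (gammaMap K A B H ρ lam (a ⊗ₜ b)) =
      antipodeMulCore eA eB eH Sinv
        (TensorProduct.map ρ.toLinearMap LinearMap.id (ρ a) ⊗ₜ
          TensorProduct.map LinearMap.id lam.toLinearMap (lam b)) := by
  simp only [gammaMap, LinearMap.comp_apply, TensorProduct.map_tmul, AlgHom.toLinearMap_apply]
  generalize ρ a = P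
  induction P with
  | zero => simp
  | add x y hx hy => simp only [map_add, TensorProduct.add_tmul, hx, hy]
  | tmul a₀ g =>
    generalize lam b = Q
    induction Q with
    | zero => simp
    | add x y hx hy => simp only [map_add, TensorProduct.tmul_add, hx, hy]
    | tmul h b₀ => simp [antipodeMulCore, jMap_eq_jCore]

/-- `(s ⊗ s') ⊗ ((h₁ ⊗ h₂) ⊗ h₃) ↦ s h₁ ⊗ (b S⁻¹(h₃) a ⊗ s' h₂)`. -/
def xiCore (eA : A →ₐ[K] X) (eB : B →ₐ[K] X) (eH : H →ₐ[K] X) (Sinv : H →ₗ[K] H)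
    (a : A) (b : B) : (H ⊗[K] H) ⊗[K] ((H ⊗[K] H) ⊗[K] H) →ₗ[K] H ⊗[K] (X ⊗[K] H) :=
  (TensorProduct.leftComm K X H H).toLinearMap
    ∘ₗ (TensorProduct.comm K (H ⊗[K] H) X).toLinearMap
    ∘ₗ TensorProduct.map (LinearMap.mul' K (H ⊗[K] H))
      (LinearMap.mulRight K (eA a) ∘ₗ LinearMap.mulLeft K (eB b) ∘ₗ eH.toLinearMap ∘ₗ Sinv)
    ∘ₗ (TensorProduct.assoc K (H ⊗[K] H) (H ⊗[K] H) H).symm.toLinearMap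

theorem xiMap_jPure (eA : A →ₐ[K] X) (eB : B →ₐ[K] X) (eH : H →ₐ[K] X) (Sinv : H →ₗ[K] H)
    (a : A) (b : B) (s : H) (P : H ⊗[K] H) :
    xiMap K X H (jPure eA eB eH Sinv a b s P) =
      xiCore eA eB eH Sinv a b (comul s ⊗ₜ TensorProduct.map comul LinearMap.id P) := by
  induction P with
  | zero => simp
  | add x y hx hy => simp only [map_add, TensorProduct.tmul_add, hx, hy]
  | tmul x y => simp [xiMap, jPure, xiCore]

theorem antipodeMulCore_assoc (eA : A →ₐ[K] X) (eB : B →ₐ[K] X) (eH : H →ₐ[K] X)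
    (Sinv : H →ₗ[K] H) (a : A) (b : B) (P Q : H ⊗[K] H) :
    antipodeMulCore eA eB eH Sinv
        ((TensorProduct.assoc K A H H).symm (a ⊗ₜ P) ⊗ₜ TensorProduct.assoc K H H B (Q ⊗ₜ b)) =
      xiCore eA eB eH Sinv a b
        (TensorProduct.comm K H H (TensorProduct.map (antipode K) (antipode K) P) ⊗ₜ
          (TensorProduct.assoc K H H H).symm (TensorProduct.map LinearMap.id comul Q)) := by
  induction P with
  | zero => simp
  | add x y hx hy => simp only [map_add, TensorProduct.tmul_add, TensorProduct.add_tmul, hx, hy]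
  | tmul p r =>
    induction Q with
    | zero => simp
    | add x y hx hy =>
      simp only [map_add, TensorProduct.tmul_add, TensorProduct.add_tmul, hx, hy]
    | tmul u w =>
      simp only [antipodeMulCore, LinearMap.comp_apply, TensorProduct.map_tmul,
        TensorProduct.assoc_symm_tmul, TensorProduct.assoc_tmul, TensorProduct.comm_tmul,
        LinearEquiv.coe_coe, LinearMap.id_coe, id_eq, jCore_tmul,
        TensorProduct.tensorTensorTensorComm_tmul, LinearMap.mul'_apply]
      generalize (comul w : H ⊗[K] H) = W
      induction W with
      | zero => simp
      | add x y hx hy => simp only [map_add, TensorProduct.tmul_add, hx, hy]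
      | tmul x y => simp [jPure, xiCore]

/-- For comodules `(A, ρ)` and `(B, lam)`, the map `jMap` intertwines `gammaMap` and `xiMap`. -/
theorem xiMap_jMap (ρ : A →ₐ[K] A ⊗[K] H) (lam : B →ₐ[K] H ⊗[K] B)
    (hρ : ∀ a, TensorProduct.assoc K A H H (TensorProduct.map ρ.toLinearMap LinearMap.id (ρ a)) =
      TensorProduct.map LinearMap.id comul (ρ a))
    (hlam : ∀ b, TensorProduct.assoc K H H B
        (TensorProduct.map comul LinearMap.id (lam b)) =
      TensorProduct.map LinearMap.id lam.toLinearMap (lam b))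
    (eA : A →ₐ[K] X) (eB : B →ₐ[K] X) (eH : H →ₐ[K] X) (Sinv : H →ₗ[K] H) (v : A ⊗[K] B) :
    xiMap K X H (jMap K H A B X ρ lam eA eB eH Sinv v) =
      TensorProduct.map LinearMap.id (jMap K H A B X ρ lam eA eB eH Sinv)
        (gammaMap K A B H ρ lam v) := by
  induction v with
  | zero => simp
  | add x y hx hy => simp only [map_add, hx, hy]
  | tmul a b =>
    rw [map_jMap_gammaMap, jMap_eq_jCore, ← hlam,
      (LinearEquiv.eq_symm_apply (TensorProduct.assoc K A H H)).2 (hρ a)]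
    generalize ρ a = P
    induction P with
    | zero => simp
    | add x y hx hy => simp only [map_add, TensorProduct.add_tmul, hx, hy]
    | tmul a₀ g =>
      generalize lam b = Q
      induction Q with
      | zero => simp
      | add x y hx hy => simp only [map_add, TensorProduct.tmul_add, hx, hy]
      | tmul h b₀ =>
        have hh : TensorProduct.map comul LinearMap.id (comul (R := K) h) =
            (TensorProduct.assoc K H H H).symm
              (TensorProduct.map LinearMap.id comul (comul (R := K) h)) :=
          (Coalgebra.coassoc_symm_apply h).symm
        rw [jCore_tmul, xiMap_jPure, TensorProduct.map_tmul, TensorProduct.map_tmul,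
          LinearMap.id_apply, LinearMap.id_apply, antipodeMulCore_assoc,
          HopfAlgebra.comul_antipode, hh]

end Comodule

/-- (case `m = n > t`) the map `j*_q : O_q(V°) → O_q(M_n^{≤t,°}) ⊗ O_q(GL_t)`,
`j*_q(a ⊗ b) = Σ b₀ S⁻¹(b₋₁) a₀ ⊗ S(a₁) b₋₂`, is a morphism of left `O_q(GL_t)`-comodules
from `(O_q(V°), γ°*_q)` to `(O_q(M_n^{≤t,°}) ⊗ O_q(GL_t), ξ*_q)`; that is,
`ξ*_q ∘ j*_q = (id ⊗ j*_q) ∘ γ°*_q`. -/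
theorem stmt8 (K : Type) [Field K] (q : K) (hq : q ≠ 0) (n t : ℕ) (ht : 0 < t) (htn : t < n)
    -- `G` is the Hopf algebra `O_q(GL_t)`, the localization of `O_q(M_t)` at the central
    -- quantum determinant `d_T`:
    (G : Type) [Ring G] [HopfAlgebra K G]
    (ιG : OqM K q t t →ₐ[K] G)
    (hcentral : ∀ g : G, ιG (qdet K q t) * g = g * ιG (qdet K q t))
    (hunit : IsUnit (ιG (qdet K q t)))
    (huniv : ∀ (C : Type) [Ring C] [Algebra K C] (f : OqM K q t t →ₐ[K] C),
      IsUnit (f (qdet K q t)) → ∃! g : G →ₐ[K] C, g.comp ιG = f)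
    -- the Hopf structure of `G` on the generators `T_{ij} = ιG X_{ij}`:
    (hΔT : ∀ i j : Fin t, Coalgebra.comul (R := K) (ιG (Xg K q i j)) =
      ∑ k : Fin t, ιG (Xg K q i k) ⊗ₜ[K] ιG (Xg K q k j))
    (hεT : ∀ i j : Fin t, Coalgebra.counit (R := K) (ιG (Xg K q i j)) =
      if i = j then (1 : K) else 0)
    -- the right coaction `ρ*_q` of `G` on `O_q(M_{n,t})`, `Y_{ij} ↦ Σ_k Y_{ik} ⊗ T_{kj}`:
    (ρ : OqM K q n t →ₐ[K] OqM K q n t ⊗[K] G)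
    (hρ : ∀ (i : Fin n) (j : Fin t),
      ρ (Xg K q i j) = ∑ k : Fin t, Xg K q i k ⊗ₜ[K] ιG (Xg K q k j))
    -- the left coaction `λ*_q` of `G` on `O_q(M_{t,n})`, `Z_{ij} ↦ Σ_k T_{ik} ⊗ Z_{kj}`:
    (lam : OqM K q t n →ₐ[K] G ⊗[K] OqM K q t n)
    (hlam : ∀ (i : Fin t) (j : Fin n),
      lam (Xg K q i j) = ∑ k : Fin t, ιG (Xg K q i k) ⊗ₜ[K] Xg K q k j)
    -- `Ao = O_q(M_{n,t}°) = O_q(M_{n,t})[d_Y⁻¹]`: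
    (Ao : Type) [Ring Ao] [Algebra K Ao] (ιY : OqM K q n t →ₐ[K] Ao)
    (hYunit : IsUnit (ιY (dY K q n t htn.le)))
    (hYuniv : ∀ (C : Type) [Ring C] [Algebra K C] (f : OqM K q n t →ₐ[K] C),
      IsUnit (f (dY K q n t htn.le)) → ∃! g : Ao →ₐ[K] C, g.comp ιY = f)
    -- `Zo = O_q(M_{t,n}°) = O_q(M_{t,n})[d_Z⁻¹]`:
    (Zo : Type) [Ring Zo] [Algebra K Zo] (ιZ : OqM K q t n →ₐ[K] Zo)
    (hZunit : IsUnit (ιZ (dZ K q n t htn.le)))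
    (hZuniv : ∀ (C : Type) [Ring C] [Algebra K C] (f : OqM K q t n →ₐ[K] C),
      IsUnit (f (dZ K q n t htn.le)) → ∃! g : Zo →ₐ[K] C, g.comp ιZ = f)
    -- `Xo = O_q(M_n^{≤t,°}) = O_q(M_n^{≤t})[d_x⁻¹]`:
    (Xo : Type) [Ring Xo] [Algebra K Xo] (ιX : OqMle K q n n t →ₐ[K] Xo)
    (hxunit : IsUnit (ιX (dx K q n t htn.le)))
    (hXuniv : ∀ (C : Type) [Ring C] [Algebra K C] (f : OqMle K q n n t →ₐ[K] C),
      IsUnit (f (dx K q n t htn.le)) → ∃! g : Xo →ₐ[K] C, g.comp ιX = f)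
    -- the localized coactions `ρ°*_q` and `λ°*_q`:
    (ρo : Ao →ₐ[K] Ao ⊗[K] G)
    (hρo : ρo.comp ιY = (Algebra.TensorProduct.map ιY (AlgHom.id K G)).comp ρ)
    (lamo : Zo →ₐ[K] G ⊗[K] Zo)
    (hlamo : lamo.comp ιZ = (Algebra.TensorProduct.map (AlgHom.id K G) ιZ).comp lam)
    -- the lower-left-corner embeddings (`inj` in the paper):
    (eA : Ao →ₐ[K] Xo)
    (heA : ∀ (i : Fin n) (j : Fin t), eA (ιY (Xg K q i j)) =
      ιX (mkle K q n n t (Xg K q i (colLeft n t htn.le j))))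
    (eZ : Zo →ₐ[K] Xo)
    (heZ : ∀ (i : Fin t) (j : Fin n), eZ (ιZ (Xg K q i j)) =
      ιX (mkle K q n n t (Xg K q (rowTop n t htn.le i) j)))
    (eG : G →ₐ[K] Xo)
    (heG : ∀ i j : Fin t, eG (ιG (Xg K q i j)) =
      ιX (mkle K q n n t (Xg K q (rowTop n t htn.le i) (colLeft n t htn.le j))))
    -- the antipode of `O_q(GL_t)` is bijective, with inverse `Sinv`:
    (Sinv : G →ₗ[K] G)
    (hSinv : ∀ g : G, Sinv (HopfAlgebra.antipode (R := K) g) = g ∧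
      HopfAlgebra.antipode (R := K) (Sinv g) = g)
    :
    ∀ v : Ao ⊗[K] Zo,
      xiMap K Xo G (jMap K G Ao Zo Xo ρo lamo eA eZ eG Sinv v) =
        (TensorProduct.map LinearMap.id (jMap K G Ao Zo Xo ρo lamo eA eZ eG Sinv))
          (gammaMap K Ao Zo G ρo lamo v) := by
  refine xiMap_jMap ρo lamo ?_ ?_ eA eZ eG Sinv
  · let f : Ao →ₐ[K] Ao ⊗[K] (G ⊗[K] G) :=
      (Algebra.TensorProduct.assoc K K K Ao G G).toAlgHom.comp
        ((Algebra.TensorProduct.map ρo (AlgHom.id K G)).comp ρo)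
    let g : Ao →ₐ[K] Ao ⊗[K] (G ⊗[K] G) :=
      (Algebra.TensorProduct.map (AlgHom.id K Ao) (Bialgebra.comulAlgHom K G)).comp ρo
    have hY (i : Fin n) (j : Fin t) : ρo (ιY (Xg K q i j)) =
        ∑ k : Fin t, ιY (Xg K q i k) ⊗ₜ[K] ιG (Xg K q k j) := by
      simpa [hρ] using congr($hρo (Xg K q i j))
    have hfg : f.comp ιY = g.comp ιY := OqM.algHom_ext fun i j => by
      simp only [f, g, AlgHom.comp_apply, hY, map_sum, Algebra.TensorProduct.map_tmul,
        AlgHom.id_apply, Bialgebra.comulAlgHom_apply, hΔT, TensorProduct.sum_tmul,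
        TensorProduct.tmul_sum]
      rw [Finset.sum_comm]
      rfl
    exact fun a => congr($((hYuniv _ (g.comp ιY) (hYunit.map g)).unique hfg rfl) a)
  · let f : Zo →ₐ[K] G ⊗[K] (G ⊗[K] Zo) :=
      (Algebra.TensorProduct.assoc K K K G G Zo).toAlgHom.comp
        ((Algebra.TensorProduct.map (Bialgebra.comulAlgHom K G) (AlgHom.id K Zo)).comp lamo)
    let g : Zo →ₐ[K] G ⊗[K] (G ⊗[K] Zo) :=
      (Algebra.TensorProduct.map (AlgHom.id K G) lamo).comp lamo
    have hZ (i : Fin t) (j : Fin n) : lamo (ιZ (Xg K q i j)) =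
        ∑ k : Fin t, ιG (Xg K q i k) ⊗ₜ[K] ιZ (Xg K q k j) := by
      simpa [hlam] using congr($hlamo (Xg K q i j))
    have hfg : f.comp ιZ = g.comp ιZ := OqM.algHom_ext fun i j => by
      simp only [f, g, AlgHom.comp_apply, hZ, map_sum, Algebra.TensorProduct.map_tmul,
        AlgHom.id_apply, Bialgebra.comulAlgHom_apply, hΔT, TensorProduct.sum_tmul,
        TensorProduct.tmul_sum]
      rw [Finset.sum_comm]
      rfl
    exact fun b => congr($((hZuniv _ (g.comp ιZ) (hZunit.map g)).unique hfg rfl) b)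

end
end

section
/- Let K be a field, q ∈ K nonzero, and n > t positive integers. The set of γ°*_q-coinvariants in O_q(V°) = O_q(M_{n,t}°) ⊗ O_q(M_{t,n}°) equals the image of the localized morphism μ°*_q; that is, O_q(V°)^{co O_q(GL_t)} = Im μ°*_q. -/
open scoped TensorProduct

noncomputable section

/-- Construct an algebra map out of `O_q(M_{u,v})` from a matrix satisfying its relations. -/
theorem OqM_exists_lift (K : Type) [Field K] (q : K) {u v : ℕ} {C : Type} [Ring C] [Algebra K C]
    (x : Fin u → Fin v → C)
    (hrow : ∀ (i : Fin u) (j k : Fin v), j < k → x i j * x i k = q • (x i k * x i j))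
    (hcol : ∀ (i k : Fin u) (j : Fin v), i < k → x i j * x k j = q • (x k j * x i j))
    (hcomm : ∀ (i k : Fin u) (j l : Fin v), i < k → l < j → x i j * x k l = x k l * x i j)
    (hquantum : ∀ (i k : Fin u) (j l : Fin v), i < k → j < l →
      x i j * x k l = x k l * x i j + (q - q⁻¹) • (x i l * x k j)) :
    ∃ f : OqM K q u v →ₐ[K] C, ∀ i j, f (Xg K q i j) = x i j := by
  refine ⟨RingQuot.liftAlgHom K ⟨FreeAlgebra.lift K fun p : Fin u × Fin v => x p.1 p.2, ?_⟩, ?_⟩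
  · intro a b h
    cases h with
    | row h => simpa using hrow _ _ _ h
    | col h => simpa using hcol _ _ _ h
    | comm h1 h2 => simpa using hcomm _ _ _ _ h1 h2
    | quantum h1 h2 => simpa using hquantum _ _ _ _ h1 h2
  · intro i j
    simp [Xg]

theorem Xg_row (K : Type) [Field K] (q : K) {u v : ℕ} (i : Fin u) {j k : Fin v} (h : j < k) :
    Xg K q i j * Xg K q i k = q • (Xg K q i k * Xg K q i j) := by
  simpa [Xg] using RingQuot.mkAlgHom_rel K (QMRel.row (K := K) (q := q) (i := i) h)

theorem Xg_col (K : Type) [Field K] (q : K) {u v : ℕ} {i k : Fin u} (j : Fin v) (h : i < k) :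
    Xg K q i j * Xg K q k j = q • (Xg K q k j * Xg K q i j) := by
  simpa [Xg] using RingQuot.mkAlgHom_rel K (QMRel.col (K := K) (q := q) (j := j) h)

theorem Xg_comm (K : Type) [Field K] (q : K) {u v : ℕ} {i k : Fin u} {j l : Fin v}
    (h1 : i < k) (h2 : l < j) : Xg K q i j * Xg K q k l = Xg K q k l * Xg K q i j := by
  simpa [Xg] using RingQuot.mkAlgHom_rel K (QMRel.comm (K := K) (q := q) h1 h2)

theorem Xg_quantum (K : Type) [Field K] (q : K) {u v : ℕ} {i k : Fin u} {j l : Fin v}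
    (h1 : i < k) (h2 : j < l) : Xg K q i j * Xg K q k l =
      Xg K q k l * Xg K q i j + (q - q⁻¹) • (Xg K q i l * Xg K q k j) := by
  simpa [Xg] using RingQuot.mkAlgHom_rel K (QMRel.quantum (K := K) (q := q) h1 h2)

theorem OqM_algHom_ext {K : Type} [Field K] {q : K} {u v : ℕ} {C : Type} [Ring C] [Algebra K C]
    {f g : OqM K q u v →ₐ[K] C} (h : ∀ i j, f (Xg K q i j) = g (Xg K q i j)) : f = g := by
  apply RingQuot.ringQuot_ext'
  apply FreeAlgebra.hom_ext
  funext p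
  exact h p.1 p.2

theorem OqM_mem_subalgebra {K : Type} [Field K] {q : K} {u v : ℕ} (S : Subalgebra K (OqM K q u v))
    (h : ∀ i j, Xg K q i j ∈ S) (a : OqM K q u v) : a ∈ S := by
  obtain ⟨f, hf⟩ := OqM_exists_lift K q (C := S) (fun i j => ⟨Xg K q i j, h i j⟩)
    (fun i j k hjk => Subtype.ext (Xg_row K q i hjk))
    (fun i k j hik => Subtype.ext (Xg_col K q j hik))
    (fun i k j l h1 h2 => Subtype.ext (Xg_comm K q h1 h2))
    (fun i k j l h1 h2 => Subtype.ext (Xg_quantum K q h1 h2))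
  have hid : S.val.comp f = AlgHom.id K _ := OqM_algHom_ext fun i j => by simp [hf]
  have := DFunLike.congr_fun hid a
  simp only [AlgHom.comp_apply, AlgHom.id_apply] at this
  rw [← this]
  exact (f a).2

/-- Strictly increasing index maps induce algebra maps of quantum matrices, compatibly with
quantum minors. -/
theorem OqM_exists_map (K : Type) [Field K] (q : K) {u v u' v' : ℕ} {R : Fin u → Fin u'}
    {C : Fin v → Fin v'} (hR : StrictMono R) (hC : StrictMono C) :
    ∃ f : OqM K q u v →ₐ[K] OqM K q u' v', ∀ i j, f (Xg K q i j) = Xg K q (R i) (C j) :=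
  OqM_exists_lift K q (fun i j => Xg K q (R i) (C j))
    (fun i _ _ h => Xg_row K q (R i) (hC h))
    (fun _ _ j h => Xg_col K q (C j) (hR h))
    (fun _ _ _ _ h1 h2 => Xg_comm K q (hR h1) (hC h2))
    (fun _ _ _ _ h1 h2 => Xg_quantum K q (hR h1) (hC h2))

theorem map_qdet (K : Type) [Field K] (q : K) {t u v : ℕ} {R : Fin t → Fin u}
    {C : Fin t → Fin v} {f : OqM K q t t →ₐ[K] OqM K q u v}
    (hf : ∀ i j, f (Xg K q i j) = Xg K q (R i) (C j)) :
    f (qdet K q t) = qMinor K q R C := by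
  simp [qdet, qMinor, map_list_prod, List.map_ofFn, Function.comp_def, hf]

theorem strictMono_rowTop (n t : ℕ) (h : t ≤ n) : StrictMono (rowTop n t h) := by
  intro a b hab
  have : a.1 < b.1 := hab
  show n - t + a.1 < n - t + b.1
  omega

theorem strictMono_colLeft (n t : ℕ) (h : t ≤ n) : StrictMono (colLeft n t h) := by
  intro a b hab
  exact hab

theorem localization_algHom_ext {K R L : Type} [Field K] [Ring R] [Algebra K R] [Ring L]
    [Algebra K L] {ι : R →ₐ[K] L} {d : R} (hunit : IsUnit (ι d))
    (huniv : ∀ (C : Type) [Ring C] [Algebra K C] (f : R →ₐ[K] C),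
      IsUnit (f d) → ∃! g : L →ₐ[K] C, g.comp ι = f)
    {C : Type} [Ring C] [Algebra K C] {f g : L →ₐ[K] C} (h : f.comp ι = g.comp ι) : f = g :=
  (huniv C (g.comp ι) (hunit.map g)).unique h rfl

theorem localization_mem_subalgebra {K R L : Type} [Field K] [Ring R] [Algebra K R] [Ring L]
    [Algebra K L] {ι : R →ₐ[K] L} {d : R} (hunit : IsUnit (ι d))
    (huniv : ∀ (C : Type) [Ring C] [Algebra K C] (f : R →ₐ[K] C),
      IsUnit (f d) → ∃! g : L →ₐ[K] C, g.comp ι = f)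
    (S : Subalgebra K L) (hι : ∀ r, ι r ∈ S)
    (hinv : ∀ x, x * ι d = 1 → ι d * x = 1 → x ∈ S) (a : L) : a ∈ S := by
  obtain ⟨e, he⟩ := hunit
  have hu : IsUnit (ι.codRestrict S hι d) := by
    have h1 : (↑e⁻¹ : L) * ι d = 1 := by rw [← he]; exact e.inv_mul
    have h2 : ι d * (↑e⁻¹ : L) = 1 := by rw [← he]; exact e.mul_inv
    exact ⟨⟨ι.codRestrict S hι d, ⟨_, hinv _ h1 h2⟩, Subtype.ext h2, Subtype.ext h1⟩, rfl⟩
  obtain ⟨g, hg, -⟩ := huniv S (ι.codRestrict S hι) hu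
  have hid : S.val.comp g = AlgHom.id K L := by
    refine localization_algHom_ext ⟨e, he⟩ huniv ?_
    rw [AlgHom.comp_assoc, hg]
    rfl
  have := DFunLike.congr_fun hid a
  simp only [AlgHom.comp_apply, AlgHom.id_apply] at this
  rw [← this]
  exact (g a).2

/-- The coefficients of the `R`-matrix acting on columns. -/
def rCoeff (K : Type) [Field K] (q : K) {t : ℕ} (b l a j : Fin t) : K :=
  (if b = l ∧ a = j then (if j = l then q⁻¹ else 1) else 0) +
    (if a = l ∧ b = j ∧ j < l then q⁻¹ - q else 0)

theorem sum_rCoeff_mul_rCoeff (K : Type) [Field K] (q : K) {t : ℕ} (b l b' l' a j : Fin t) :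
    ∑ m, rCoeff K q b l a m * rCoeff K q b' l' m j =
      (if b = l ∧ b' = l' ∧ a = j then (if j = l then q⁻¹ else 1) * (if j = l' then q⁻¹ else 1)
        else 0) +
      (if b = l ∧ a = l' ∧ b' = j ∧ j < l' then (if l' = l then q⁻¹ else 1) * (q⁻¹ - q) else 0) +
      (if a = l ∧ b' = l' ∧ b = j ∧ j < l then (if j = l' then q⁻¹ else 1) * (q⁻¹ - q) else 0) +
      (if a = l ∧ b = l' ∧ b' = j ∧ j < l' ∧ l' < l then (q⁻¹ - q) ^ 2 else 0) := by
  have e : ∀ m, rCoeff K q b l a m * rCoeff K q b' l' m j =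
      (if m = a then (if b = l then (if a = l then q⁻¹ else 1) * rCoeff K q b' l' a j else 0)
        else 0) +
      (if m = b then (if a = l ∧ b < l then (q⁻¹ - q) * rCoeff K q b' l' b j else 0) else 0) := by
    intro m
    simp only [rCoeff]
    grind
  rw [Finset.sum_congr rfl fun m _ => e m]
  simp only [Finset.sum_add_distrib, Finset.sum_ite_eq', Finset.mem_univ, if_true]
  simp only [rCoeff]
  clear e
  generalize q⁻¹ = p
  grind (splits := 40)

theorem exists_rMatrix_rep (K : Type) [Field K] (q : K) (hq : q ≠ 0) (t : ℕ) :
    ∃ f : OqM K q t t →ₐ[K] Matrix (Fin t) (Fin t) K,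
      (∀ b l, f (Xg K q b l) = Matrix.of fun a j => rCoeff K q b l a j) := by
  have hqq : q * q⁻¹ = 1 := mul_inv_cancel₀ hq
  refine OqM_exists_lift K q _ ?_ ?_ ?_ ?_
  all_goals
    intros
    ext a j
    simp only [Matrix.mul_apply, Matrix.of_apply, Matrix.smul_apply, Matrix.add_apply,
      sum_rCoeff_mul_rCoeff, smul_eq_mul]
    clear hq
    generalize q⁻¹ = p at *
    grind (splits := 40)

theorem isUnit_rMatrix_qdet (K : Type) [Field K] (q : K) (hq : q ≠ 0) (t : ℕ)
    (f : OqM K q t t →ₐ[K] Matrix (Fin t) (Fin t) K)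
    (hf : ∀ b l, f (Xg K q b l) = Matrix.of fun a j => rCoeff K q b l a j) :
    IsUnit (f (qdet K q t)) := by
  have hsum : f (qdet K q t) = ∑ σ : Equiv.Perm (Fin t), ((-q) ^ invCount σ) •
      (List.ofFn fun i : Fin t => f (Xg K q i (σ i))).prod := by
    simp [qdet, qMinor, map_list_prod, List.map_ofFn, Function.comp_def]
  rw [hsum, Finset.sum_eq_single 1]
  · rw [Algebra.smul_def]
    refine IsUnit.mul (IsUnit.map _ (IsUnit.pow _ (neg_ne_zero.mpr hq).isUnit)) ?_
    refine List.prod_isUnit fun m hm => ?_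
    obtain ⟨i, rfl⟩ := (List.mem_ofFn' _ _).mp hm
    have hdiag : f (Xg K q i ((1 : Equiv.Perm (Fin t)) i)) =
        Matrix.diagonal fun j => if j = i then q⁻¹ else 1 := by
      rw [hf]
      ext a j
      simp only [rCoeff, Matrix.of_apply, Matrix.diagonal_apply, Equiv.Perm.one_apply]
      grind
    beta_reduce
    rw [hdiag, Matrix.isUnit_diagonal, Pi.isUnit_iff]
    intro j
    split_ifs
    · exact (inv_ne_zero hq).isUnit
    · exact isUnit_one
  · intro σ _ hσ
    obtain ⟨i, hi⟩ : ∃ i, σ i < i := by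
      by_contra! hle
      apply hσ
      have hs : ∑ i : Fin t, (i : ℕ) = ∑ i : Fin t, (σ i : ℕ) :=
        (Equiv.sum_comp σ fun i : Fin t => (i : ℕ)).symm
      have := (Finset.sum_eq_sum_iff_of_le fun i _ => (Fin.le_def.mp (hle i))).mp hs
      ext i
      simpa using (this i (Finset.mem_univ i)).symm
    rw [List.prod_eq_zero, smul_zero]
    refine (List.mem_ofFn' _ _).mpr ⟨i, ?_⟩
    beta_reduce
    rw [hf]
    ext a j
    simp only [rCoeff, Matrix.of_apply, Matrix.zero_apply]
    grind
  · simp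

/-- The elements whose left multiplication on the row vector `w` is given by `Φ`. -/
def leftIntertwiner {K G A m : Type} [Field K] [Ring G] [Algebra K G] [Ring A] [Algebra K A]
    [Fintype m] [DecidableEq m] (φ : G →ₐ[K] A) (Φ : G →ₐ[K] Matrix m m A) (w : m → A) :
    Subalgebra K G where
  carrier := {h | φ h • w = Matrix.vecMul w (Φ h)}
  mul_mem' := by
    intro a b ha hb
    simp only [Set.mem_ofPred_eq] at *
    rw [map_mul, map_mul, mul_smul, hb, ← Matrix.vecMul_vecMul, ← ha, Matrix.smul_vecMul]
  add_mem' := by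
    intro a b ha hb
    simp only [Set.mem_ofPred_eq] at *
    rw [map_add, map_add, add_smul, ha, hb, Matrix.vecMul_add]
  algebraMap_mem' := by
    intro r
    simp only [Set.mem_ofPred_eq, AlgHom.commutes]
    rw [Algebra.algebraMap_eq_smul_one (A := Matrix m m A), Matrix.vecMul_smul, Matrix.vecMul_one,
      algebraMap_smul]

theorem leftIntertwiner_inv_mem {K G A m : Type} [Field K] [Ring G] [Algebra K G] [Ring A]
    [Algebra K A] [Fintype m] [DecidableEq m] {φ : G →ₐ[K] A} {Φ : G →ₐ[K] Matrix m m A}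
    {w : m → A} {h h' : G} (hh : h ∈ leftIntertwiner φ Φ w) (h1 : h' * h = 1) (h2 : h * h' = 1) :
    h' ∈ leftIntertwiner φ Φ w := by
  have hh : φ h • w = Matrix.vecMul w (Φ h) := hh
  change φ h' • w = Matrix.vecMul w (Φ h')
  calc φ h' • w = φ h' • Matrix.vecMul w (Φ (h * h')) := by rw [h2, map_one, Matrix.vecMul_one]
    _ = φ h' • Matrix.vecMul (φ h • w) (Φ h') := by rw [map_mul, ← Matrix.vecMul_vecMul, hh]
    _ = Matrix.vecMul w (Φ h') := by
      rw [Matrix.smul_vecMul, smul_smul, ← map_mul, h1, map_one, one_smul]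

/-- The elements whose right multiplication on the column vector `w` is given by `Ψ`. -/
def rightIntertwiner {K G A m : Type} [Field K] [Ring G] [Algebra K G] [Ring A] [Algebra K A]
    [Fintype m] [DecidableEq m] (φ : G →ₐ[K] A) (Ψ : G →ₐ[K] Matrix m m A) (w : m → A) :
    Subalgebra K G where
  carrier := {h | MulOpposite.op (φ h) • w = Matrix.mulVec (Ψ h) w}
  mul_mem' := by
    intro a b ha hb
    simp only [Set.mem_ofPred_eq] at *
    rw [map_mul, map_mul, MulOpposite.op_mul, mul_smul, ha, ← Matrix.mulVec_mulVec, ← hb,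
      Matrix.mulVec_smul]
  add_mem' := by
    intro a b ha hb
    simp only [Set.mem_ofPred_eq] at *
    rw [map_add, map_add, MulOpposite.op_add, add_smul, ha, hb, Matrix.add_mulVec]
  algebraMap_mem' := by
    intro r
    simp only [Set.mem_ofPred_eq, AlgHom.commutes]
    rw [Algebra.algebraMap_eq_smul_one (A := Matrix m m A), Matrix.smul_mulVec, Matrix.one_mulVec]
    funext i
    simp [Algebra.smul_def, Algebra.commutes]

theorem rightIntertwiner_inv_mem {K G A m : Type} [Field K] [Ring G] [Algebra K G] [Ring A]
    [Algebra K A] [Fintype m] [DecidableEq m] {φ : G →ₐ[K] A} {Ψ : G →ₐ[K] Matrix m m A}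
    {w : m → A} {h h' : G} (hh : h ∈ rightIntertwiner φ Ψ w) (h1 : h' * h = 1) (h2 : h * h' = 1) :
    h' ∈ rightIntertwiner φ Ψ w := by
  have hh : MulOpposite.op (φ h) • w = Matrix.mulVec (Ψ h) w := hh
  change MulOpposite.op (φ h') • w = Matrix.mulVec (Ψ h') w
  calc MulOpposite.op (φ h') • w = MulOpposite.op (φ h') • Matrix.mulVec (Ψ (h' * h)) w := by
        rw [h1, map_one, Matrix.one_mulVec]
    _ = MulOpposite.op (φ h') • Matrix.mulVec (Ψ h') (MulOpposite.op (φ h) • w) := by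
        rw [map_mul, ← Matrix.mulVec_mulVec, hh]
    _ = Matrix.mulVec (Ψ h') w := by
      rw [Matrix.mulVec_smul, smul_smul, ← MulOpposite.op_mul, ← map_mul, h2, map_one,
        MulOpposite.op_one, one_smul]

theorem mul_eq_top_of_commute_right {K A : Type} [Field K] [Ring A] [Algebra K A]
    (U J : Subalgebra K A) (s : Set A) (hs : s ⊆ U)
    (hcomm : ∀ x ∈ J, ∀ y ∈ s, x * y ∈ Submodule.span K s * Subalgebra.toSubmodule J)
    (hgen : Algebra.adjoin K (s ∪ J) = ⊤) :
    Subalgebra.toSubmodule U * Subalgebra.toSubmodule J = ⊤ := by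
  set V := Algebra.adjoin K s with hV
  set D := Subalgebra.toSubmodule V * Subalgebra.toSubmodule J with hD
  have hVD : ∀ x ∈ V, ∀ d ∈ D, x * d ∈ D := by
    intro x hx d hd
    induction hd using Submodule.mul_induction_on' with
    | mem_mul_mem a ha b hb =>
      rw [← mul_assoc]
      exact Submodule.mul_mem_mul (V.mul_mem hx ha) hb
    | add a _ b _ ha hb => rw [mul_add]; exact D.add_mem ha hb
  have hJV : ∀ y ∈ V, ∀ x ∈ J, x * y ∈ D := by
    intro y hy
    induction hy using Algebra.adjoin_induction with
    | mem y hy =>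
      intro x hx
      exact mul_le_mul_left (show Submodule.span K s ≤ Subalgebra.toSubmodule V from
        Submodule.span_le.mpr Algebra.subset_adjoin) _ (hcomm x hx y hy)
    | algebraMap r =>
      intro x hx
      rw [← Algebra.commutes]
      exact Submodule.mul_mem_mul (V.algebraMap_mem r) hx
    | add y y' _ _ h h' => intro x hx; rw [mul_add]; exact D.add_mem (h x hx) (h' x hx)
    | mul y y' _ _ h h' =>
      intro x hx
      rw [← mul_assoc]
      have key : ∀ d ∈ D, d * y' ∈ D := by
        intro d hd
        induction hd using Submodule.mul_induction_on' with
        | mem_mul_mem a ha b hb => rw [mul_assoc]; exact hVD a ha _ (h' b hb)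
        | add a _ b _ ha hb => rw [add_mul]; exact D.add_mem ha hb
      exact key _ (h x hx)
  have hJD : ∀ x ∈ J, ∀ d ∈ D, x * d ∈ D := by
    intro x hx d hd
    induction hd using Submodule.mul_induction_on' with
    | mem_mul_mem a ha b hb =>
      rw [← mul_assoc]
      have key : ∀ d ∈ D, d * b ∈ D := by
        intro d hd
        induction hd using Submodule.mul_induction_on' with
        | mem_mul_mem a' ha' b' hb' =>
          rw [mul_assoc]; exact Submodule.mul_mem_mul ha' (J.mul_mem hb' hb)
        | add a _ b _ ha hb => rw [add_mul]; exact D.add_mem ha hb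
      exact key _ (hJV a ha x hx)
    | add a _ b _ ha hb => rw [mul_add]; exact D.add_mem ha hb
  have hall : ∀ a ∈ Algebra.adjoin K (s ∪ J), ∀ d ∈ D, a * d ∈ D := by
    intro a ha
    induction ha using Algebra.adjoin_induction with
    | mem y hy =>
      rcases hy with hy | hy
      · exact hVD y (Algebra.subset_adjoin hy)
      · exact hJD y hy
    | algebraMap r => intro d hd; rw [← Algebra.smul_def]; exact D.smul_mem r hd
    | add y y' _ _ h h' => intro d hd; rw [add_mul]; exact D.add_mem (h d hd) (h' d hd)
    | mul y y' _ _ h h' => intro d hd; rw [mul_assoc]; exact h _ (h' d hd)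
  have h1 : (1 : A) ∈ D := by
    simpa using Submodule.mul_mem_mul (show (1 : A) ∈ Subalgebra.toSubmodule V from V.one_mem)
      (show (1 : A) ∈ Subalgebra.toSubmodule J from J.one_mem)
  refine eq_top_iff.mpr fun a _ => ?_
  have ha : a ∈ D := by
    simpa using hall a (by rw [hgen]; exact Algebra.mem_top) 1 h1
  exact mul_le_mul_left (show Subalgebra.toSubmodule V ≤ _ from Algebra.adjoin_le hs) _ ha

theorem mul_eq_top_of_commute_left {K A : Type} [Field K] [Ring A] [Algebra K A]
    (U J : Subalgebra K A) (s : Set A) (hs : s ⊆ U)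
    (hcomm : ∀ x ∈ J, ∀ y ∈ s, y * x ∈ Subalgebra.toSubmodule J * Submodule.span K s)
    (hgen : Algebra.adjoin K (s ∪ J) = ⊤) :
    Subalgebra.toSubmodule J * Subalgebra.toSubmodule U = ⊤ := by
  set V := Algebra.adjoin K s with hV
  set D := Subalgebra.toSubmodule J * Subalgebra.toSubmodule V with hD
  have hVD : ∀ x ∈ V, ∀ d ∈ D, d * x ∈ D := by
    intro x hx d hd
    induction hd using Submodule.mul_induction_on' with
    | mem_mul_mem a ha b hb =>
      rw [mul_assoc]
      exact Submodule.mul_mem_mul ha (V.mul_mem hb hx)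
    | add a _ b _ ha hb => rw [add_mul]; exact D.add_mem ha hb
  have hJV : ∀ y ∈ V, ∀ x ∈ J, y * x ∈ D := by
    intro y hy
    induction hy using Algebra.adjoin_induction with
    | mem y hy =>
      intro x hx
      exact mul_le_mul_right (show Submodule.span K s ≤ Subalgebra.toSubmodule V from
        Submodule.span_le.mpr Algebra.subset_adjoin) _ (hcomm x hx y hy)
    | algebraMap r =>
      intro x hx
      rw [Algebra.commutes]
      exact Submodule.mul_mem_mul hx (V.algebraMap_mem r)
    | add y y' _ _ h h' => intro x hx; rw [add_mul]; exact D.add_mem (h x hx) (h' x hx)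
    | mul y y' _ _ h h' =>
      intro x hx
      rw [mul_assoc]
      have key : ∀ d ∈ D, y * d ∈ D := by
        intro d hd
        induction hd using Submodule.mul_induction_on' with
        | mem_mul_mem a ha b hb => rw [← mul_assoc]; exact hVD b hb _ (h a ha)
        | add a _ b _ ha hb => rw [mul_add]; exact D.add_mem ha hb
      exact key _ (h' x hx)
  have hJD : ∀ x ∈ J, ∀ d ∈ D, d * x ∈ D := by
    intro x hx d hd
    induction hd using Submodule.mul_induction_on' with
    | mem_mul_mem a ha b hb =>
      rw [mul_assoc]
      have key : ∀ d ∈ D, a * d ∈ D := by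
        intro d hd
        induction hd using Submodule.mul_induction_on' with
        | mem_mul_mem a' ha' b' hb' =>
          rw [← mul_assoc]; exact Submodule.mul_mem_mul (J.mul_mem ha ha') hb'
        | add a _ b _ ha hb => rw [mul_add]; exact D.add_mem ha hb
      exact key _ (hJV b hb x hx)
    | add a _ b _ ha hb => rw [add_mul]; exact D.add_mem ha hb
  have hall : ∀ a ∈ Algebra.adjoin K (s ∪ J), ∀ d ∈ D, d * a ∈ D := by
    intro a ha
    induction ha using Algebra.adjoin_induction with
    | mem y hy =>
      rcases hy with hy | hy
      · exact hVD y (Algebra.subset_adjoin hy)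
      · exact hJD y hy
    | algebraMap r =>
      intro d hd; rw [← Algebra.commutes, ← Algebra.smul_def]; exact D.smul_mem r hd
    | add y y' _ _ h h' => intro d hd; rw [mul_add]; exact D.add_mem (h d hd) (h' d hd)
    | mul y y' _ _ h h' => intro d hd; rw [← mul_assoc]; exact h' _ (h d hd)
  have h1 : (1 : A) ∈ D := by
    simpa using Submodule.mul_mem_mul (show (1 : A) ∈ Subalgebra.toSubmodule J from J.one_mem)
      (show (1 : A) ∈ Subalgebra.toSubmodule V from V.one_mem)
  refine eq_top_iff.mpr fun a _ => ?_
  have ha : a ∈ D := by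
    simpa using hall a (by rw [hgen]; exact Algebra.mem_top) 1 h1
  exact mul_le_mul_right (show Subalgebra.toSubmodule V ≤ _ from Algebra.adjoin_le hs) _ ha

/-- Multiplication matrices: `Φ = (id ⊗ r) ∘ Δ` and `Ψ = (r ⊗ id) ∘ Δ` for the representation `r`
given by the `R`-matrix. -/
theorem exists_twists (K : Type) [Field K] (q : K) (hq : q ≠ 0) (t : ℕ)
    (G : Type) [Ring G] [Bialgebra K G] (ιG : OqM K q t t →ₐ[K] G)
    (huniv : ∀ (C : Type) [Ring C] [Algebra K C] (f : OqM K q t t →ₐ[K] C),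
      IsUnit (f (qdet K q t)) → ∃! g : G →ₐ[K] C, g.comp ιG = f)
    (hΔT : ∀ i j : Fin t, Coalgebra.comul (R := K) (ιG (Xg K q i j)) =
      ∑ k : Fin t, ιG (Xg K q i k) ⊗ₜ[K] ιG (Xg K q k j)) :
    ∃ Φ Ψ : G →ₐ[K] Matrix (Fin t) (Fin t) G,
      (∀ k l a j, Φ (ιG (Xg K q k l)) a j = ∑ b, rCoeff K q b l a j • ιG (Xg K q k b)) ∧
      (∀ k l i a, Ψ (ιG (Xg K q k l)) i a = ∑ b, rCoeff K q k b i a • ιG (Xg K q b l)) := by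
  obtain ⟨f, hf⟩ := exists_rMatrix_rep K q hq t
  obtain ⟨r, hr, -⟩ := huniv _ f (isUnit_rMatrix_qdet K q hq t f hf)
  have hr' : ∀ b l, r (ιG (Xg K q b l)) = Matrix.of fun a j => rCoeff K q b l a j := fun b l => by
    rw [← hf b l, ← hr]; rfl
  let e := (matrixEquivTensor (Fin t) K G).symm.toAlgHom
  have he : ∀ (g : G) (M : Matrix (Fin t) (Fin t) K) a j, e (g ⊗ₜ M) a j = M a j • g := by
    intro g M a j
    simp [e, Algebra.smul_def, Algebra.commutes]
  let m := Algebra.TensorProduct.map (AlgHom.id K G) r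
  refine ⟨(e.comp m).comp (Bialgebra.comulAlgHom K G),
    ((e.comp m).comp (Algebra.TensorProduct.comm K G G).toAlgHom).comp
      (Bialgebra.comulAlgHom K G), fun k l a j => ?_, fun k l i a => ?_⟩
  · simp [hΔT, m, hr', Matrix.sum_apply, he]
  · simp [hΔT, m, hr', Matrix.sum_apply, he]

theorem antipode_matrix_inv (K : Type) [Field K] {t : ℕ} {G : Type} [Ring G] [HopfAlgebra K G]
    (T : Matrix (Fin t) (Fin t) G)
    (hΔ : ∀ i j, Coalgebra.comul (R := K) (T i j) = ∑ k, T i k ⊗ₜ[K] T k j)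
    (hε : ∀ i j, Coalgebra.counit (R := K) (T i j) = if i = j then (1 : K) else 0) :
    T * T.map (HopfAlgebra.antipode K) = 1 ∧ T.map (HopfAlgebra.antipode K) * T = 1 := by
  constructor
  · ext i j
    have := HopfAlgebra.mul_antipode_lTensor_comul_apply (R := K) (T i j)
    rw [hΔ, hε] at this
    simpa [Matrix.mul_apply, Matrix.one_apply, apply_ite] using this
  · ext i j
    have := HopfAlgebra.mul_antipode_rTensor_comul_apply (R := K) (T i j)
    rw [hΔ, hε] at this
    simpa [Matrix.mul_apply, Matrix.one_apply, apply_ite] using this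

theorem sum_rCoeff_smul_left {K M : Type} [Field K] [AddCommGroup M] [Module K M] (q : K) {t : ℕ}
    (l c : Fin t) (F : Fin t → Fin t → M) :
    ∑ a, ∑ b, rCoeff K q b l a c • F a b =
      (if c = l then q⁻¹ else 1) • F c l + if c < l then (q⁻¹ - q) • F l c else 0 := by
  simp [rCoeff, add_smul, ite_and, Finset.sum_add_distrib, ite_smul]

theorem sum_rCoeff_smul_right {K M : Type} [Field K] [AddCommGroup M] [Module K M] (q : K) {t : ℕ}
    (k i : Fin t) (F : Fin t → Fin t → M) :
    ∑ a, ∑ b, rCoeff K q k b i a • F a b =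
      (if i = k then q⁻¹ else 1) • F i k + if k < i then (q⁻¹ - q) • F k i else 0 := by
  simp [rCoeff, add_smul, ite_and, Finset.sum_add_distrib, ite_smul]

theorem Xg_mul_eq_of_row_lt (K : Type) [Field K] (q : K) (hq : q ≠ 0) {n t : ℕ} {i r : Fin n}
    (h : i < r) (l c : Fin t) :
    Xg K q r l * Xg K q i c =
      ∑ a, ∑ b, rCoeff K q b l a c • (Xg K q i a * Xg K q r b) := by
  rw [sum_rCoeff_smul_left q l c fun a b => Xg K q i a * Xg K q r b]
  rcases lt_trichotomy c l with hcl | rfl | hcl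
  · rw [if_neg hcl.ne, if_pos hcl, Xg_quantum K q h hcl]
    module
  · simp [Xg_col K q c h, smul_smul, hq]
  · rw [if_neg hcl.ne', if_neg hcl.asymm, Xg_comm K q h hcl]
    simp

theorem Xg_mul_eq_of_col_lt (K : Type) [Field K] (q : K) (hq : q ≠ 0) {n t : ℕ} {l c : Fin n}
    (h : l < c) (k i : Fin t) :
    Xg K q i c * Xg K q k l =
      ∑ a, ∑ b, rCoeff K q k b i a • (Xg K q b l * Xg K q a c) := by
  rw [sum_rCoeff_smul_right q k i fun a b => Xg K q b l * Xg K q a c]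
  rcases lt_trichotomy k i with hki | rfl | hki
  · rw [if_neg hki.ne', if_pos hki, Xg_quantum K q hki h, Xg_comm K q hki h]
    module
  · simp [Xg_row K q k h, smul_smul, hq]
  · rw [if_neg hki.ne, if_neg hki.asymm, Xg_comm K q hki h]
    simp

/-- `O_q(M_{n,t}°)` is the product of a subalgebra containing the normalized minors
`u = Y T⁻¹` with the image of `O_q(GL_t)`. -/
theorem localized_left_decomposition (K : Type) [Field K] (q : K) (hq : q ≠ 0) (n t : ℕ)
    (htn : t ≤ n) (G : Type) [Ring G] [Bialgebra K G] (ιG : OqM K q t t →ₐ[K] G)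
    (hunit : IsUnit (ιG (qdet K q t)))
    (huniv : ∀ (C : Type) [Ring C] [Algebra K C] (f : OqM K q t t →ₐ[K] C),
      IsUnit (f (qdet K q t)) → ∃! g : G →ₐ[K] C, g.comp ιG = f)
    (hΔT : ∀ i j : Fin t, Coalgebra.comul (R := K) (ιG (Xg K q i j)) =
      ∑ k : Fin t, ιG (Xg K q i k) ⊗ₜ[K] ιG (Xg K q k j))
    (A : Type) [Ring A] [Algebra K A] (ιY : OqM K q n t →ₐ[K] A)
    (hYunit : IsUnit (ιY (dY K q n t htn)))
    (hYuniv : ∀ (C : Type) [Ring C] [Algebra K C] (f : OqM K q n t →ₐ[K] C),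
      IsUnit (f (dY K q n t htn)) → ∃! g : A →ₐ[K] C, g.comp ιY = f)
    (j : G →ₐ[K] A) (hj : ∀ k l, j (ιG (Xg K q k l)) = ιY (Xg K q (rowTop n t htn k) l))
    (hjd : j (ιG (qdet K q t)) = ιY (dY K q n t htn))
    (T' : Matrix (Fin t) (Fin t) G)
    (hT1 : Matrix.of (fun k l => ιG (Xg K q k l)) * T' = 1)
    (hT2 : T' * Matrix.of (fun k l => ιG (Xg K q k l)) = 1)
    (U : Subalgebra K A) (hU : ∀ i c, ∑ k, ιY (Xg K q i k) * j (T' k c) ∈ U) :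
    Subalgebra.toSubmodule U * Subalgebra.toSubmodule j.range = ⊤ := by
  obtain ⟨Φ, -, hΦ, -⟩ := exists_twists K q hq t G ιG huniv hΔT
  set T : Matrix (Fin t) (Fin t) G := Matrix.of (fun k l => ιG (Xg K q k l)) with hT
  have hmT : j.mapMatrix T * j.mapMatrix T' = 1 := by rw [← map_mul, hT1, map_one]
  have hmT' : j.mapMatrix T' * j.mapMatrix T = 1 := by rw [← map_mul, hT2, map_one]
  let w : Fin n → Fin t → A := fun i k => ιY (Xg K q i k)
  let u : Fin n → Fin t → A := fun i => Matrix.vecMul (w i) (j.mapMatrix T')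
  have hwu : ∀ i, w i = Matrix.vecMul (u i) (j.mapMatrix T) := by
    intro i
    simp only [u, Matrix.vecMul_vecMul, hmT', Matrix.vecMul_one]
  have hutop : ∀ k c, u (rowTop n t htn k) c = (1 : Matrix (Fin t) (Fin t) A) k c := by
    intro k c
    rw [← hmT]
    simp [u, w, Matrix.vecMul, dotProduct, Matrix.mul_apply, hT, hj]
  have htwist : ∀ i : Fin n, (i : ℕ) < n - t → ∀ h, h ∈ leftIntertwiner j (j.mapMatrix.comp Φ) (w i) := by
    intro i hi
    have hgen : ∀ k l, ιG (Xg K q k l) ∈ leftIntertwiner j (j.mapMatrix.comp Φ) (w i) := by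
      intro k l
      change j (ιG (Xg K q k l)) • w i = Matrix.vecMul (w i) (j.mapMatrix (Φ (ιG (Xg K q k l))))
      have hlt : i < rowTop n t htn k := by
        rw [Fin.lt_def]
        change (i : ℕ) < n - t + k
        omega
      funext c
      simp only [Pi.smul_apply, smul_eq_mul, w, hj, Matrix.vecMul, dotProduct,
        AlgHom.mapMatrix_apply, Matrix.map_apply, hΦ, map_sum, map_smul, ← map_mul,
        Xg_mul_eq_of_row_lt K q hq hlt, Finset.mul_sum, mul_smul_comm]
    have hι : ∀ r, ιG r ∈ leftIntertwiner j (j.mapMatrix.comp Φ) (w i) := fun r =>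
      OqM_mem_subalgebra ((leftIntertwiner j (j.mapMatrix.comp Φ) (w i)).comap ιG) hgen r
    exact localization_mem_subalgebra hunit huniv _ hι fun x h1 h2 =>
      leftIntertwiner_inv_mem (hι _) h1 h2
  refine mul_eq_top_of_commute_right U j.range (Set.range fun p : Fin n × Fin t => u p.1 p.2)
    ?_ ?_ ?_
  · rintro _ ⟨⟨i, c⟩, rfl⟩
    exact hU i c
  · rintro _ ⟨h, rfl⟩ _ ⟨⟨i, c⟩, rfl⟩
    have hus : ∀ a, u i a ∈ Submodule.span K (Set.range fun p : Fin n × Fin t => u p.1 p.2) :=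
      fun a => Submodule.subset_span ⟨(i, a), rfl⟩
    by_cases hi : (i : ℕ) < n - t
    · have key : j h • u i = Matrix.vecMul (u i) (j.mapMatrix (T * Φ h * T')) := by
        have hh : j h • w i = Matrix.vecMul (w i) (j.mapMatrix (Φ h)) := htwist i hi h
        calc j h • u i = Matrix.vecMul (j h • w i) (j.mapMatrix T') := by
              rw [Matrix.smul_vecMul]
          _ = _ := by
            rw [hh]
            nth_rewrite 1 [hwu i]
            rw [Matrix.vecMul_vecMul, Matrix.vecMul_vecMul, map_mul, map_mul, Matrix.mul_assoc]
      have key' := congrFun key c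
      change j h * u i c = _ at key'
      change j h * u i c ∈ _
      rw [key']
      change ∑ a, u i a * j ((T * Φ h * T') a c) ∈ _
      refine Submodule.sum_mem _ fun a _ => ?_
      exact Submodule.mul_mem_mul (hus a) (AlgHom.mem_range_self j ((T * Φ h * T') a c))
    · obtain ⟨k, rfl⟩ : ∃ k, i = rowTop n t htn k := by
        refine ⟨⟨i - (n - t), by omega⟩, Fin.ext ?_⟩
        change (i : ℕ) = n - t + (i - (n - t))
        omega
      have hc : j h * u (rowTop n t htn k) c = u (rowTop n t htn k) c * j h := by
        rw [hutop, Matrix.one_apply]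
        split_ifs <;> simp
      change j h * u (rowTop n t htn k) c ∈ _
      rw [hc]
      exact Submodule.mul_mem_mul (hus c) (AlgHom.mem_range_self j _)
  · set S := Algebra.adjoin K
      ((Set.range fun p : Fin n × Fin t => u p.1 p.2) ∪ (j.range : Set A)) with hS
    have hjS : ∀ h, j h ∈ S := fun h => Algebra.subset_adjoin (Or.inr ⟨h, rfl⟩)
    have hι : ∀ r, ιY r ∈ S := by
      refine fun r => OqM_mem_subalgebra (S.comap ιY) (fun i c => ?_) r
      change w i c ∈ S
      rw [hwu i]
      change ∑ a, u i a * j.mapMatrix T a c ∈ S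
      exact Subalgebra.sum_mem _ fun a _ =>
        S.mul_mem (Algebra.subset_adjoin (Or.inl ⟨(i, a), rfl⟩)) (hjS _)
    refine eq_top_iff.mpr fun a _ => localization_mem_subalgebra hYunit hYuniv S hι ?_ a
    intro x h1 h2
    obtain ⟨e, he⟩ := hunit
    have : x = j (↑e⁻¹ : G) := by
      have h3 : ιY (dY K q n t htn) * j (↑e⁻¹ : G) = 1 := by
        rw [← hjd, ← he, ← map_mul, e.mul_inv, map_one]
      calc x = x * (ιY (dY K q n t htn) * j (↑e⁻¹ : G)) := by rw [h3, mul_one]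
        _ = _ := by rw [← mul_assoc, h1, one_mul]
    rw [this]
    exact hjS _

/-- `O_q(M_{t,n}°)` is the product of the image of `O_q(GL_t)` with a subalgebra containing the
normalized minors `T⁻¹ Z`. -/
theorem localized_right_decomposition (K : Type) [Field K] (q : K) (hq : q ≠ 0) (n t : ℕ)
    (htn : t ≤ n) (G : Type) [Ring G] [Bialgebra K G] (ιG : OqM K q t t →ₐ[K] G)
    (hunit : IsUnit (ιG (qdet K q t)))
    (huniv : ∀ (C : Type) [Ring C] [Algebra K C] (f : OqM K q t t →ₐ[K] C),
      IsUnit (f (qdet K q t)) → ∃! g : G →ₐ[K] C, g.comp ιG = f)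
    (hΔT : ∀ i j : Fin t, Coalgebra.comul (R := K) (ιG (Xg K q i j)) =
      ∑ k : Fin t, ιG (Xg K q i k) ⊗ₜ[K] ιG (Xg K q k j))
    (B : Type) [Ring B] [Algebra K B] (ιZ : OqM K q t n →ₐ[K] B)
    (hZunit : IsUnit (ιZ (dZ K q n t htn)))
    (hZuniv : ∀ (C : Type) [Ring C] [Algebra K C] (f : OqM K q t n →ₐ[K] C),
      IsUnit (f (dZ K q n t htn)) → ∃! g : B →ₐ[K] C, g.comp ιZ = f)
    (j : G →ₐ[K] B) (hj : ∀ k l, j (ιG (Xg K q k l)) = ιZ (Xg K q k (colLeft n t htn l)))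
    (hjd : j (ιG (qdet K q t)) = ιZ (dZ K q n t htn))
    (T' : Matrix (Fin t) (Fin t) G)
    (hT1 : Matrix.of (fun k l => ιG (Xg K q k l)) * T' = 1)
    (hT2 : T' * Matrix.of (fun k l => ιG (Xg K q k l)) = 1)
    (U : Subalgebra K B) (hU : ∀ i c, ∑ k, j (T' i k) * ιZ (Xg K q k c) ∈ U) :
    Subalgebra.toSubmodule j.range * Subalgebra.toSubmodule U = ⊤ := by
  obtain ⟨-, Ψ, -, hΨ⟩ := exists_twists K q hq t G ιG huniv hΔT
  set T : Matrix (Fin t) (Fin t) G := Matrix.of (fun k l => ιG (Xg K q k l)) with hT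
  have hmT : j.mapMatrix T * j.mapMatrix T' = 1 := by rw [← map_mul, hT1, map_one]
  have hmT' : j.mapMatrix T' * j.mapMatrix T = 1 := by rw [← map_mul, hT2, map_one]
  let w : Fin n → Fin t → B := fun c k => ιZ (Xg K q k c)
  let u : Fin n → Fin t → B := fun c => Matrix.mulVec (j.mapMatrix T') (w c)
  have hwu : ∀ c, w c = Matrix.mulVec (j.mapMatrix T) (u c) := by
    intro c
    simp only [u, Matrix.mulVec_mulVec, hmT, Matrix.one_mulVec]
  have hutop : ∀ l i, u (colLeft n t htn l) i = (1 : Matrix (Fin t) (Fin t) B) i l := by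
    intro l i
    rw [← hmT']
    simp [u, w, Matrix.mulVec, dotProduct, Matrix.mul_apply, hT, hj]
  have htwist : ∀ c : Fin n, t ≤ c → ∀ h, h ∈ rightIntertwiner j (j.mapMatrix.comp Ψ) (w c) := by
    intro c hc
    have hgen : ∀ k l, ιG (Xg K q k l) ∈ rightIntertwiner j (j.mapMatrix.comp Ψ) (w c) := by
      intro k l
      change MulOpposite.op (j (ιG (Xg K q k l))) • w c =
        Matrix.mulVec (j.mapMatrix (Ψ (ιG (Xg K q k l)))) (w c)
      have hlt : colLeft n t htn l < c := by
        rw [Fin.lt_def]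
        change (l : ℕ) < c
        omega
      funext i
      simp only [Pi.smul_apply, MulOpposite.smul_eq_mul_unop, MulOpposite.unop_op, w, hj,
        Matrix.mulVec, dotProduct, AlgHom.mapMatrix_apply, Matrix.map_apply, hΨ, map_sum, map_smul,
        ← map_mul, Xg_mul_eq_of_col_lt K q hq hlt, Finset.sum_mul, smul_mul_assoc]
    have hι : ∀ r, ιG r ∈ rightIntertwiner j (j.mapMatrix.comp Ψ) (w c) := fun r =>
      OqM_mem_subalgebra ((rightIntertwiner j (j.mapMatrix.comp Ψ) (w c)).comap ιG) hgen r
    exact localization_mem_subalgebra hunit huniv _ hι fun x h1 h2 =>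
      rightIntertwiner_inv_mem (hι _) h1 h2
  refine mul_eq_top_of_commute_left U j.range (Set.range fun p : Fin n × Fin t => u p.1 p.2)
    ?_ ?_ ?_
  · rintro _ ⟨⟨c, i⟩, rfl⟩
    exact hU i c
  · rintro _ ⟨h, rfl⟩ _ ⟨⟨c, i⟩, rfl⟩
    have hus : ∀ a, u c a ∈ Submodule.span K (Set.range fun p : Fin n × Fin t => u p.1 p.2) :=
      fun a => Submodule.subset_span ⟨(c, a), rfl⟩
    by_cases hc : t ≤ (c : ℕ)
    · have key : MulOpposite.op (j h) • u c =
          Matrix.mulVec (j.mapMatrix (T' * (Ψ h * T))) (u c) := by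
        have hh : MulOpposite.op (j h) • w c = Matrix.mulVec (j.mapMatrix (Ψ h)) (w c) :=
          htwist c hc h
        calc MulOpposite.op (j h) • u c =
              Matrix.mulVec (j.mapMatrix T') (MulOpposite.op (j h) • w c) := by
              rw [Matrix.mulVec_smul]
          _ = _ := by
            rw [hh]
            nth_rewrite 1 [hwu c]
            rw [Matrix.mulVec_mulVec, Matrix.mulVec_mulVec, map_mul, map_mul, Matrix.mul_assoc]
      have key' := congrFun key i
      change u c i * j h = _ at key'
      change u c i * j h ∈ _
      rw [key']
      change ∑ a, j ((T' * (Ψ h * T)) i a) * u c a ∈ _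
      refine Submodule.sum_mem _ fun a _ => ?_
      exact Submodule.mul_mem_mul (AlgHom.mem_range_self j ((T' * (Ψ h * T)) i a)) (hus a)
    · obtain ⟨l, rfl⟩ : ∃ l, c = colLeft n t htn l :=
        ⟨⟨c, by omega⟩, rfl⟩
      have hcm : u (colLeft n t htn l) i * j h = j h * u (colLeft n t htn l) i := by
        rw [hutop, Matrix.one_apply]
        split_ifs <;> simp
      change u (colLeft n t htn l) i * j h ∈ _
      rw [hcm]
      exact Submodule.mul_mem_mul (AlgHom.mem_range_self j _) (hus i)
  · set S := Algebra.adjoin K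
      ((Set.range fun p : Fin n × Fin t => u p.1 p.2) ∪ (j.range : Set B)) with hS
    have hjS : ∀ h, j h ∈ S := fun h => Algebra.subset_adjoin (Or.inr ⟨h, rfl⟩)
    have hι : ∀ r, ιZ r ∈ S := by
      refine fun r => OqM_mem_subalgebra (S.comap ιZ) (fun i c => ?_) r
      change w c i ∈ S
      rw [hwu c]
      change ∑ a, j.mapMatrix T i a * u c a ∈ S
      exact Subalgebra.sum_mem _ fun a _ =>
        S.mul_mem (hjS _) (Algebra.subset_adjoin (Or.inl ⟨(c, a), rfl⟩))
    refine eq_top_iff.mpr fun a _ => localization_mem_subalgebra hZunit hZuniv S hι ?_ a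
    intro x h1 h2
    obtain ⟨e, he⟩ := hunit
    have : x = j (↑e⁻¹ : G) := by
      have h3 : ιZ (dZ K q n t htn) * j (↑e⁻¹ : G) = 1 := by
        rw [← hjd, ← he, ← map_mul, e.mul_inv, map_one]
      calc x = x * (ιZ (dZ K q n t htn) * j (↑e⁻¹ : G)) := by rw [h3, mul_one]
        _ = _ := by rw [← mul_assoc, h1, one_mul]
    rw [this]
    exact hjS _

/-- For a right coaction `ρ` of a Hopf algebra, the twisted coinvariants of `gammaMap` are the
elements equalizing `ρ ⊗ id` and `id ⊗ λ`. -/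
theorem gammaMap_eq_one_tmul_iff {K A B H : Type} [Field K] [Ring A] [Algebra K A] [Ring B]
    [Algebra K B] [Ring H] [HopfAlgebra K H] (ρ : A →ₐ[K] A ⊗[K] H) (lam : B →ₐ[K] H ⊗[K] B)
    (hcoassoc : ∀ a, TensorProduct.assoc K A H H (TensorProduct.map ρ.toLinearMap .id (ρ a)) =
      TensorProduct.map .id Coalgebra.comul (ρ a))
    (hcounit : ∀ a, TensorProduct.map .id (Algebra.linearMap K H ∘ₗ Coalgebra.counit) (ρ a) =
      a ⊗ₜ[K] (1 : H)) (w : A ⊗[K] B) :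
    gammaMap K A B H ρ lam w = (1 : H) ⊗ₜ[K] w ↔
      Algebra.TensorProduct.assoc K K K A H B (Algebra.TensorProduct.map ρ (.id K B) w) =
        Algebra.TensorProduct.map (.id K A) lam w := by
  let S : H →ₗ[K] H := HopfAlgebra.antipode K
  let κ : A ⊗[K] H →ₗ[K] A ⊗[K] H := TensorProduct.map .id (LinearMap.mul' K H) ∘ₗ
    (TensorProduct.assoc K A H H).toLinearMap ∘ₗ TensorProduct.map ρ.toLinearMap .id
  let θ : A ⊗[K] H →ₗ[K] A ⊗[K] H :=
    TensorProduct.map .id (LinearMap.mul' K H ∘ₗ TensorProduct.map S .id) ∘ₗ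
    (TensorProduct.assoc K A H H).toLinearMap ∘ₗ TensorProduct.map ρ.toLinearMap .id
  have hκ_one : ∀ a, κ (a ⊗ₜ 1) = ρ a := by
    intro a
    have : ∀ x : A ⊗[K] H, TensorProduct.map .id (LinearMap.mul' K H)
        (TensorProduct.assoc K A H H (x ⊗ₜ 1)) = x := fun x => by
      induction x with
      | zero => simp
      | add x y hx hy => rw [TensorProduct.add_tmul, map_add, map_add, hx, hy]
      | tmul a g => simp
    simpa [κ] using this (ρ a)
  have hθ_ρ : ∀ a, θ (ρ a) = a ⊗ₜ 1 := by
    intro a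
    change TensorProduct.map .id (LinearMap.mul' K H ∘ₗ TensorProduct.map S .id)
      (TensorProduct.assoc K A H H (TensorProduct.map ρ.toLinearMap .id (ρ a))) = _
    rw [hcoassoc, ← hcounit, ← LinearMap.comp_apply, ← TensorProduct.map_comp]
    congr 2
    exact HopfAlgebra.mul_antipode_rTensor_comul
  have hκθ : ∀ x, κ (θ x) = x := by
    have hκ_mul : ∀ x g, κ (x * (1 ⊗ₜ g)) = κ x * (1 ⊗ₜ g) := by
      intro x g
      induction x with
      | zero => simp
      | add x y hx hy => rw [add_mul, map_add, map_add, hx, hy, add_mul]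
      | tmul a h =>
        have : ∀ x : A ⊗[K] H, TensorProduct.map .id (LinearMap.mul' K H)
            (TensorProduct.assoc K A H H (x ⊗ₜ (h * g))) =
            TensorProduct.map .id (LinearMap.mul' K H)
            (TensorProduct.assoc K A H H (x ⊗ₜ h)) * (1 ⊗ₜ g) := fun x => by
          induction x with
          | zero => simp
          | add x y hx hy => simp only [TensorProduct.add_tmul, map_add, hx, hy, add_mul]
          | tmul a g => simp [mul_assoc]
        simpa [κ] using this (ρ a)
    have hθ_tmul : ∀ a g, θ (a ⊗ₜ g) = TensorProduct.map .id S (ρ a) * (1 ⊗ₜ g) := by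
      intro a g
      have : ∀ x : A ⊗[K] H, TensorProduct.map .id (LinearMap.mul' K H ∘ₗ TensorProduct.map S .id)
          (TensorProduct.assoc K A H H (x ⊗ₜ g)) = TensorProduct.map .id S x * (1 ⊗ₜ g) := fun x => by
        induction x with
        | zero => simp
        | add x y hx hy => simp only [TensorProduct.add_tmul, map_add, hx, hy, add_mul]
        | tmul a g => simp
      simpa [θ] using this (ρ a)
    have hκS : ∀ a, κ (TensorProduct.map .id S (ρ a)) = a ⊗ₜ 1 := by
      intro a
      have : ∀ x : A ⊗[K] H, κ (TensorProduct.map .id S x) =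
          TensorProduct.map .id (LinearMap.mul' K H ∘ₗ TensorProduct.map .id S)
          (TensorProduct.assoc K A H H (TensorProduct.map ρ.toLinearMap .id x)) := fun x => by
        induction x with
        | zero => simp
        | add x y hx hy => simp only [map_add, hx, hy]
        | tmul a g =>
          have : ∀ x : A ⊗[K] H, TensorProduct.map .id (LinearMap.mul' K H)
              (TensorProduct.assoc K A H H (x ⊗ₜ S g)) =
              TensorProduct.map .id (LinearMap.mul' K H ∘ₗ TensorProduct.map .id S)
              (TensorProduct.assoc K A H H (x ⊗ₜ g)) := fun x => by
            induction x with
            | zero => simp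
            | add x y hx hy => simp only [TensorProduct.add_tmul, map_add, hx, hy]
            | tmul a g => simp
          simpa [κ] using this (ρ a)
      rw [this, hcoassoc, ← hcounit, ← LinearMap.comp_apply, ← TensorProduct.map_comp]
      congr 2
      exact HopfAlgebra.mul_antipode_lTensor_comul
    intro x
    induction x with
    | zero => simp
    | add x y hx hy => rw [map_add, map_add, hx, hy]
    | tmul a g => rw [hθ_tmul, hκ_mul, hκS]; simp
  let e : (A ⊗[K] H) ⊗[K] B ≃ₗ[K] H ⊗[K] (A ⊗[K] B) :=
    (TensorProduct.congr (TensorProduct.comm K A H) (.refl K B)).trans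
      (TensorProduct.assoc K H A B)
  let ε : (A ⊗[K] H) ⊗[K] B ≃ₗ[K] A ⊗[K] (H ⊗[K] B) := TensorProduct.assoc K A H B
  have hγ : ∀ w, gammaMap K A B H ρ lam w = e (TensorProduct.map θ .id
      (ε.symm (Algebra.TensorProduct.map (.id K A) lam w))) := by
    intro w
    induction w with
    | zero => simp
    | add x y hx hy => simp only [map_add, hx, hy]
    | tmul a b =>
      have hx : ∀ (x : A ⊗[K] H) (h : H) (b : B),
          TensorProduct.map (LinearMap.mul' K H ∘ₗ TensorProduct.map S .id) .id
            (TensorProduct.tensorTensorTensorComm K H A H B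
              (TensorProduct.comm K A H x ⊗ₜ (h ⊗ₜ b))) =
          e (TensorProduct.map .id (LinearMap.mul' K H ∘ₗ TensorProduct.map S .id)
            (TensorProduct.assoc K A H H (x ⊗ₜ h)) ⊗ₜ b) := fun x h b => by
        induction x with
        | zero => simp
        | add x y hx hy => simp only [TensorProduct.add_tmul, map_add, hx, hy]
        | tmul a g => simp [e]
      have hy : ∀ y : H ⊗[K] B,
          TensorProduct.map (LinearMap.mul' K H ∘ₗ TensorProduct.map S .id) .id
            (TensorProduct.tensorTensorTensorComm K H A H B
              (TensorProduct.comm K A H (ρ a) ⊗ₜ y)) =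
          e (TensorProduct.map θ .id (ε.symm (a ⊗ₜ y))) := fun y => by
        induction y with
        | zero => simp
        | add x y hx hy => simp only [TensorProduct.tmul_add, map_add, hx, hy]
        | tmul h b => simpa [ε, θ] using hx (ρ a) h b
      exact hy (lam b)
  have hone : ∀ w : A ⊗[K] B, (1 : H) ⊗ₜ[K] w =
      e (TensorProduct.map (TensorProduct.mk K A H |>.flip 1) .id w) := by
    intro w
    induction w with
    | zero => simp
    | add x y hx hy => simp only [TensorProduct.tmul_add, map_add, hx, hy]
    | tmul a b => simp [e]
  have hα : ∀ w : A ⊗[K] B, Algebra.TensorProduct.assoc K K K A H B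
      (Algebra.TensorProduct.map ρ (.id K B) w) = ε (TensorProduct.map ρ.toLinearMap .id w) :=
    fun w => rfl
  rw [hγ, hone, hα, EmbeddingLike.apply_eq_iff_eq]
  set z := Algebra.TensorProduct.map (.id K A) lam w
  have hκ' : κ ∘ₗ (TensorProduct.mk K A H |>.flip 1) = ρ.toLinearMap := LinearMap.ext hκ_one
  have hθ' : θ ∘ₗ ρ.toLinearMap = (TensorProduct.mk K A H |>.flip 1) := LinearMap.ext hθ_ρ
  have hid : κ ∘ₗ θ = .id := LinearMap.ext hκθ
  constructor
  · intro h
    have := congrArg (TensorProduct.map κ LinearMap.id) h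
    rw [← LinearMap.comp_apply, ← LinearMap.comp_apply, ← TensorProduct.map_comp,
      ← TensorProduct.map_comp, hκ', hid] at this
    rw [LinearMap.comp_id, TensorProduct.map_id] at this
    rw [← this]
    simp
  · intro h
    rw [← h, ε.symm_apply_apply, ← hθ', ← LinearMap.comp_apply, ← TensorProduct.map_comp,
      LinearMap.comp_id]

/-- If `A` and `B` are generated by their coinvariants and by the image of `G`, and a subalgebra
of `A ⊗ B` contains these coinvariants and the image of the comultiplication, then it contains the
cotensor product of `A` and `B`. -/
theorem cotensor_le_of_decomposition {K A B G : Type} [Field K] [Ring A] [Algebra K A] [Ring B]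
    [Algebra K B] [Ring G] [HopfAlgebra K G] (ρ : A →ₐ[K] A ⊗[K] G) (lam : B →ₐ[K] G ⊗[K] B)
    (j : G →ₐ[K] A) (j' : G →ₐ[K] B)
    (hρj : ∀ g, ρ (j g) = Algebra.TensorProduct.map j (.id K G) (Coalgebra.comul (R := K) g))
    (hlamj : ∀ g, lam (j' g) = Algebra.TensorProduct.map (.id K G) j' (Coalgebra.comul (R := K) g))
    (M : Subalgebra K (A ⊗[K] B))
    (hM : ∀ g, Algebra.TensorProduct.map j j' (Coalgebra.comul (R := K) g) ∈ M)
    (U : Subalgebra K A) (hUρ : ∀ u ∈ U, ρ u = u ⊗ₜ 1) (hUM : ∀ u ∈ U, u ⊗ₜ 1 ∈ M)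
    (hU : Subalgebra.toSubmodule U * Subalgebra.toSubmodule j.range = ⊤)
    (V : Subalgebra K B) (hVlam : ∀ v ∈ V, lam v = 1 ⊗ₜ v) (hVM : ∀ v ∈ V, 1 ⊗ₜ v ∈ M)
    (hV : Subalgebra.toSubmodule j'.range * Subalgebra.toSubmodule V = ⊤)
    (w : A ⊗[K] B)
    (hw : Algebra.TensorProduct.assoc K K K A G B (Algebra.TensorProduct.map ρ (.id K B) w) =
      Algebra.TensorProduct.map (.id K A) lam w) : w ∈ M := by
  let S : G →ₗ[K] G := HopfAlgebra.antipode K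
  let P : A →ₗ[K] A := LinearMap.mul' K A ∘ₗ TensorProduct.map .id (j.toLinearMap ∘ₗ S) ∘ₗ
    ρ.toLinearMap
  have hA_ind : ∀ p : Submodule K A, (∀ u ∈ U, ∀ h, u * j h ∈ p) → ∀ a, a ∈ p := by
    intro p hp a
    have : Subalgebra.toSubmodule U * Subalgebra.toSubmodule j.range ≤ p := by
      rw [Submodule.mul_le]
      rintro u hu _ ⟨h, rfl⟩
      exact hp u hu h
    exact this (hU ▸ Submodule.mem_top)
  have hB_ind : ∀ p : Submodule K B, (∀ h, ∀ v ∈ V, j' h * v ∈ p) → ∀ b, b ∈ p := by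
    intro p hp b
    have : Subalgebra.toSubmodule j'.range * Subalgebra.toSubmodule V ≤ p := by
      rw [Submodule.mul_le]
      rintro _ ⟨h, rfl⟩ v hv
      exact hp h v hv
    exact this (hV ▸ Submodule.mem_top)
  have hP : ∀ u ∈ U, ∀ h, P (u * j h) = Coalgebra.counit (R := K) h • u := by
    intro u hu h
    have : ∀ x : G ⊗[K] G, LinearMap.mul' K A (TensorProduct.map .id (j.toLinearMap ∘ₗ S)
        ((u ⊗ₜ 1) * Algebra.TensorProduct.map j (.id K G) x)) =
        u * j (LinearMap.mul' K G (TensorProduct.map .id S x)) := fun x => by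
      induction x with
      | zero => simp
      | add x y hx hy => simp only [map_add, mul_add, hx, hy]
      | tmul a g => simp [mul_assoc]
    change LinearMap.mul' K A (TensorProduct.map .id (j.toLinearMap ∘ₗ S) (ρ (u * j h))) = _
    rw [map_mul, hUρ u hu, hρj, this]
    have hS := HopfAlgebra.mul_antipode_lTensor_comul_apply (R := K) h
    rw [LinearMap.lTensor] at hS
    rw [hS, AlgHom.commutes, Algebra.smul_def, Algebra.commutes]
  have hPM : ∀ a, P a ⊗ₜ 1 ∈ M := by
    refine hA_ind ((Subalgebra.toSubmodule M).comap
      ((TensorProduct.mk K A B |>.flip 1) ∘ₗ P)) fun u hu h => ?_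
    change P (u * j h) ⊗ₜ 1 ∈ M
    rw [hP u hu, ← TensorProduct.smul_tmul']
    exact M.smul_mem (hUM u hu) _
  have hPj : ∀ a, LinearMap.mul' K A (TensorProduct.map P j.toLinearMap (ρ a)) = a := by
    refine hA_ind (LinearMap.eqLocus (LinearMap.mul' K A ∘ₗ TensorProduct.map P j.toLinearMap ∘ₗ
      ρ.toLinearMap) .id) fun u hu h => ?_
    have : ∀ x : G ⊗[K] G, LinearMap.mul' K A (TensorProduct.map P j.toLinearMap
        ((u ⊗ₜ 1) * Algebra.TensorProduct.map j (.id K G) x)) =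
        u * j (TensorProduct.lid K G (TensorProduct.map Coalgebra.counit .id x)) := fun x => by
      induction x with
      | zero => simp
      | add x y hx hy => simp only [map_add, mul_add, hx, hy]
      | tmul a g => simp [hP u hu]
    change LinearMap.mul' K A (TensorProduct.map P j.toLinearMap (ρ (u * j h))) = u * j h
    rw [map_mul, hUρ u hu, hρj, this]
    have hc := Coalgebra.rTensor_counit_comul (R := K) h
    rw [LinearMap.rTensor] at hc
    rw [hc]
    simp
  have hlamM : ∀ b, Algebra.TensorProduct.map j (.id K B) (lam b) ∈ M := by
    refine hB_ind ((Subalgebra.toSubmodule M).comap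
      ((Algebra.TensorProduct.map j (.id K B)).comp lam).toLinearMap) fun h v hv => ?_
    change Algebra.TensorProduct.map j (.id K B) (lam (j' h * v)) ∈ M
    rw [map_mul, hVlam v hv, hlamj, map_mul]
    have hcomp : Algebra.TensorProduct.map j (.id K B) (Algebra.TensorProduct.map (.id K G) j'
        (Coalgebra.comul (R := K) h)) =
        Algebra.TensorProduct.map j j' (Coalgebra.comul (R := K) h) := by
      rw [← AlgHom.comp_apply, ← Algebra.TensorProduct.map_comp]
      simp
    rw [hcomp]
    refine M.mul_mem (hM h) ?_
    simpa using hVM v hv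
  let Q : A ⊗[K] (G ⊗[K] B) →ₗ[K] A ⊗[K] B :=
    TensorProduct.map (LinearMap.mul' K A) .id ∘ₗ (TensorProduct.assoc K A A B).symm.toLinearMap ∘ₗ
      TensorProduct.map P (TensorProduct.map j.toLinearMap .id)
  have hQα : ∀ w, Q (Algebra.TensorProduct.assoc K K K A G B
      (Algebra.TensorProduct.map ρ (.id K B) w)) = w := by
    intro w
    induction w with
    | zero => simp
    | add x y hx hy => simp only [map_add, hx, hy]
    | tmul a b =>
      have : ∀ x : A ⊗[K] G, Q (TensorProduct.assoc K A G B (x ⊗ₜ b)) =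
          LinearMap.mul' K A (TensorProduct.map P j.toLinearMap x) ⊗ₜ b := fun x => by
        induction x with
        | zero => simp
        | add x y hx hy => simp only [TensorProduct.add_tmul, map_add, hx, hy]
        | tmul a g => simp [Q]
      refine (this (ρ a)).trans ?_
      rw [hPj]
  have hQβ : ∀ w, Q (Algebra.TensorProduct.map (.id K A) lam w) ∈ M := by
    intro w
    induction w with
    | zero => simp
    | add x y hx hy => simpa only [map_add] using M.add_mem hx hy
    | tmul a b =>
      have : ∀ y : G ⊗[K] B, Q (a ⊗ₜ y) =
          (P a ⊗ₜ 1) * Algebra.TensorProduct.map j (.id K B) y := fun y => by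
        induction y with
        | zero => simp
        | add x y hx hy => simp only [TensorProduct.tmul_add, map_add, hx, hy, mul_add]
        | tmul g b => simp [Q]
      rw [Algebra.TensorProduct.map_tmul, AlgHom.id_apply, this]
      exact M.mul_mem (hPM a) (hlamM b)
  rw [← hQα w, hw]
  exact hQβ w

theorem mul_right_inv_eq_of_common_factor {R m k : Type} [Ring R] [Fintype k] [DecidableEq k]
    {Y Y₁ : Matrix m k R} {J J' J₁ J₁' N : Matrix k k R} (hY : Y = Y₁ * N) (hJ : J = J₁ * N)
    (hJJ' : J * J' = 1) (hJ₁ : J₁' * J₁ = 1) : Y * J' = Y₁ * J₁' := by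
  calc Y * J' = Y₁ * (J₁' * J₁) * N * J' := by rw [hJ₁, hY, Matrix.mul_one]
    _ = Y₁ * J₁' * (J * J') := by rw [hJ]; simp only [Matrix.mul_assoc]
    _ = _ := by rw [hJJ', Matrix.mul_one]

theorem mul_left_inv_eq_of_common_factor {R m k : Type} [Ring R] [Fintype k] [DecidableEq k]
    {Z Z₁ : Matrix k m R} {J J' J₁ J₁' N : Matrix k k R} (hZ : Z = N * Z₁) (hJ : J = N * J₁)
    (hJJ' : J' * J = 1) (hJ₁ : J₁ * J₁' = 1) : J' * Z = J₁' * Z₁ := by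
  calc J' * Z = J' * N * (J₁ * J₁') * Z₁ := by rw [hJ₁, hZ, Matrix.mul_one, Matrix.mul_assoc]
    _ = J' * J * (J₁' * Z₁) := by rw [hJ]; simp only [Matrix.mul_assoc]
    _ = _ := by rw [hJJ', Matrix.one_mul]

/-- `O_q(GL_t)` maps to any algebra in which the image of the corresponding quantum minor is
invertible. -/
theorem exists_lift_of_isUnit_qMinor (K : Type) [Field K] (q : K) {t u v : ℕ} {G : Type} [Ring G]
    [Algebra K G] {ιG : OqM K q t t →ₐ[K] G}
    (huniv : ∀ (C : Type) [Ring C] [Algebra K C] (f : OqM K q t t →ₐ[K] C),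
      IsUnit (f (qdet K q t)) → ∃! g : G →ₐ[K] C, g.comp ιG = f)
    {R : Fin t → Fin u} {C : Fin t → Fin v} (hR : StrictMono R) (hC : StrictMono C)
    {L : Type} [Ring L] [Algebra K L] (f : OqM K q u v →ₐ[K] L)
    (hf : IsUnit (f (qMinor K q R C))) :
    ∃ j : G →ₐ[K] L, (∀ k l, j (ιG (Xg K q k l)) = f (Xg K q (R k) (C l))) ∧
      j (ιG (qdet K q t)) = f (qMinor K q R C) := by
  obtain ⟨m, hm⟩ := OqM_exists_map K q hR hC
  have hmd := map_qdet K q hm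
  obtain ⟨j, hj, -⟩ := huniv L (f.comp m) (by rw [AlgHom.comp_apply, hmd]; exact hf)
  have hj' : ∀ x, j (ιG x) = f (m x) := fun x => DFunLike.congr_fun hj x
  exact ⟨j, fun k l => by rw [hj', hm], by rw [hj', hmd]⟩

theorem localized_coaction_coassoc {K : Type} [Field K] {q : K} {n t : ℕ} {G : Type} [Ring G]
    [Bialgebra K G] {T : Fin t → Fin t → G}
    (hΔT : ∀ i j, Coalgebra.comul (R := K) (T i j) = ∑ k, T i k ⊗ₜ[K] T k j)
    {A : Type} [Ring A] [Algebra K A] {ιY : OqM K q n t →ₐ[K] A} {d : OqM K q n t}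
    (hYunit : IsUnit (ιY d))
    (hYuniv : ∀ (C : Type) [Ring C] [Algebra K C] (f : OqM K q n t →ₐ[K] C),
      IsUnit (f d) → ∃! g : A →ₐ[K] C, g.comp ιY = f)
    {ρ : A →ₐ[K] A ⊗[K] G}
    (hρ : ∀ i j, ρ (ιY (Xg K q i j)) = ∑ k, ιY (Xg K q i k) ⊗ₜ[K] T k j) (a : A) :
    TensorProduct.assoc K A G G (TensorProduct.map ρ.toLinearMap .id (ρ a)) =
      TensorProduct.map .id Coalgebra.comul (ρ a) := by
  have h : (Algebra.TensorProduct.assoc K K K A G G).toAlgHom.comp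
      ((Algebra.TensorProduct.map ρ (.id K G)).comp ρ) =
      (Algebra.TensorProduct.map (.id K A) (Bialgebra.comulAlgHom K G)).comp ρ := by
    refine localization_algHom_ext hYunit hYuniv (OqM_algHom_ext fun i c => ?_)
    simp only [AlgHom.comp_apply, hρ, map_sum, Algebra.TensorProduct.map_tmul, AlgHom.id_apply,
      Bialgebra.comulAlgHom_apply, hΔT, TensorProduct.sum_tmul, TensorProduct.tmul_sum]
    rw [Finset.sum_comm]
    rfl
  exact DFunLike.congr_fun h a

theorem localized_coaction_counit {K : Type} [Field K] {q : K} {n t : ℕ} {G : Type} [Ring G]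
    [Bialgebra K G] {T : Fin t → Fin t → G}
    (hεT : ∀ i j, Coalgebra.counit (R := K) (T i j) = if i = j then (1 : K) else 0)
    {A : Type} [Ring A] [Algebra K A] {ιY : OqM K q n t →ₐ[K] A} {d : OqM K q n t}
    (hYunit : IsUnit (ιY d))
    (hYuniv : ∀ (C : Type) [Ring C] [Algebra K C] (f : OqM K q n t →ₐ[K] C),
      IsUnit (f d) → ∃! g : A →ₐ[K] C, g.comp ιY = f)
    {ρ : A →ₐ[K] A ⊗[K] G}
    (hρ : ∀ i j, ρ (ιY (Xg K q i j)) = ∑ k, ιY (Xg K q i k) ⊗ₜ[K] T k j) (a : A) :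
    TensorProduct.map .id (Algebra.linearMap K G ∘ₗ Coalgebra.counit) (ρ a) = a ⊗ₜ[K] (1 : G) := by
  have h : (Algebra.TensorProduct.map (.id K A)
      ((Algebra.ofId K G).comp (Bialgebra.counitAlgHom K G))).comp ρ =
      Algebra.TensorProduct.includeLeft := by
    refine localization_algHom_ext hYunit hYuniv (OqM_algHom_ext fun i c => ?_)
    simp [hρ, hεT, Algebra.ofId_apply, apply_ite]
  exact DFunLike.congr_fun h a

/-- (case `m = n > t`) the set of `γ°*_q`-coinvariants in
`O_q(V°) = O_q(M_{n,t}°) ⊗ O_q(M_{t,n}°)` equals the image of the localized morphism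
`μ°*_q : O_q(M_n^{≤t,°}) → O_q(V°)`. -/
theorem stmt10 (K : Type) [Field K] (q : K) (hq : q ≠ 0) (n t : ℕ) (ht : 0 < t) (htn : t < n)
    -- `G` is the Hopf algebra `O_q(GL_t)`, the localization of `O_q(M_t)` at the central
    -- quantum determinant `d_T`:
    (G : Type) [Ring G] [HopfAlgebra K G]
    (ιG : OqM K q t t →ₐ[K] G)
    (hcentral : ∀ g : G, ιG (qdet K q t) * g = g * ιG (qdet K q t))
    (hunit : IsUnit (ιG (qdet K q t)))
    (huniv : ∀ (C : Type) [Ring C] [Algebra K C] (f : OqM K q t t →ₐ[K] C),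
      IsUnit (f (qdet K q t)) → ∃! g : G →ₐ[K] C, g.comp ιG = f)
    -- the Hopf structure of `G` on the generators `T_{ij} = ιG X_{ij}`:
    (hΔT : ∀ i j : Fin t, Coalgebra.comul (R := K) (ιG (Xg K q i j)) =
      ∑ k : Fin t, ιG (Xg K q i k) ⊗ₜ[K] ιG (Xg K q k j))
    (hεT : ∀ i j : Fin t, Coalgebra.counit (R := K) (ιG (Xg K q i j)) =
      if i = j then (1 : K) else 0)
    -- the right coaction `ρ*_q` of `G` on `O_q(M_{n,t})`, `Y_{ij} ↦ Σ_k Y_{ik} ⊗ T_{kj}`: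
    (ρ : OqM K q n t →ₐ[K] OqM K q n t ⊗[K] G)
    (hρ : ∀ (i : Fin n) (j : Fin t),
      ρ (Xg K q i j) = ∑ k : Fin t, Xg K q i k ⊗ₜ[K] ιG (Xg K q k j))
    -- the left coaction `λ*_q` of `G` on `O_q(M_{t,n})`, `Z_{ij} ↦ Σ_k T_{ik} ⊗ Z_{kj}`:
    (lam : OqM K q t n →ₐ[K] G ⊗[K] OqM K q t n)
    (hlam : ∀ (i : Fin t) (j : Fin n),
      lam (Xg K q i j) = ∑ k : Fin t, ιG (Xg K q i k) ⊗ₜ[K] Xg K q k j)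
    -- `Ao = O_q(M_{n,t}°) = O_q(M_{n,t})[d_Y⁻¹]`:
    (Ao : Type) [Ring Ao] [Algebra K Ao] (ιY : OqM K q n t →ₐ[K] Ao)
    (hYunit : IsUnit (ιY (dY K q n t htn.le)))
    (hYuniv : ∀ (C : Type) [Ring C] [Algebra K C] (f : OqM K q n t →ₐ[K] C),
      IsUnit (f (dY K q n t htn.le)) → ∃! g : Ao →ₐ[K] C, g.comp ιY = f)
    -- `Zo = O_q(M_{t,n}°) = O_q(M_{t,n})[d_Z⁻¹]`:
    (Zo : Type) [Ring Zo] [Algebra K Zo] (ιZ : OqM K q t n →ₐ[K] Zo)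
    (hZunit : IsUnit (ιZ (dZ K q n t htn.le)))
    (hZuniv : ∀ (C : Type) [Ring C] [Algebra K C] (f : OqM K q t n →ₐ[K] C),
      IsUnit (f (dZ K q n t htn.le)) → ∃! g : Zo →ₐ[K] C, g.comp ιZ = f)
    -- `Xo = O_q(M_n^{≤t,°}) = O_q(M_n^{≤t})[d_x⁻¹]`:
    (Xo : Type) [Ring Xo] [Algebra K Xo] (ιX : OqMle K q n n t →ₐ[K] Xo)
    (hxunit : IsUnit (ιX (dx K q n t htn.le)))
    (hXuniv : ∀ (C : Type) [Ring C] [Algebra K C] (f : OqMle K q n n t →ₐ[K] C),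
      IsUnit (f (dx K q n t htn.le)) → ∃! g : Xo →ₐ[K] C, g.comp ιX = f)
    -- the localized coactions `ρ°*_q` and `λ°*_q`:
    (ρo : Ao →ₐ[K] Ao ⊗[K] G)
    (hρo : ρo.comp ιY = (Algebra.TensorProduct.map ιY (AlgHom.id K G)).comp ρ)
    (lamo : Zo →ₐ[K] G ⊗[K] Zo)
    (hlamo : lamo.comp ιZ = (Algebra.TensorProduct.map (AlgHom.id K G) ιZ).comp lam)
    -- `μ*_q : O_q(M_n^{≤t}) → O_q(M_{n,t}) ⊗ O_q(M_{t,n})` and its localized extension `μ°*_q`: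
    (μ : OqMle K q n n t →ₐ[K] OqM K q n t ⊗[K] OqM K q t n)
    (hμ : ∀ (i j : Fin n),
      μ (mkle K q n n t (Xg K q i j)) = ∑ k : Fin t, Xg K q i k ⊗ₜ[K] Xg K q k j)
    (μo : Xo →ₐ[K] Ao ⊗[K] Zo)
    (hμo : μo.comp ιX = (Algebra.TensorProduct.map ιY ιZ).comp μ)
    :
    {w : Ao ⊗[K] Zo | gammaMap K Ao Zo G ρo lamo w = (1 : G) ⊗ₜ[K] w} = Set.range μo := by
  set T : Matrix (Fin t) (Fin t) G := Matrix.of (fun k l => ιG (Xg K q k l)) with hT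
  obtain ⟨hT1, hT2⟩ := antipode_matrix_inv K T hΔT hεT
  set T' : Matrix (Fin t) (Fin t) G := T.map (HopfAlgebra.antipode K)
  have hr := strictMono_rowTop n t htn.le
  have hc := strictMono_colLeft n t htn.le
  have hρg : ∀ i c, ρo (ιY (Xg K q i c)) = ∑ k, ιY (Xg K q i k) ⊗ₜ[K] ιG (Xg K q k c) :=
    fun i c => by
      rw [← AlgHom.comp_apply, hρo, AlgHom.comp_apply, hρ]
      simp
  have hlamg : ∀ i c, lamo (ιZ (Xg K q i c)) = ∑ k, ιG (Xg K q i k) ⊗ₜ[K] ιZ (Xg K q k c) :=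
    fun i c => by
      rw [← AlgHom.comp_apply, hlamo, AlgHom.comp_apply, hlam]
      simp
  let x : OqM K q n n →ₐ[K] Xo := ιX.comp (mkle K q n n t)
  have hμg : ∀ i c, μo (x (Xg K q i c)) = ∑ k, ιY (Xg K q i k) ⊗ₜ[K] ιZ (Xg K q k c) :=
    fun i c => by
      change (μo.comp ιX) (mkle K q n n t (Xg K q i c)) = _
      rw [hμo, AlgHom.comp_apply, hμ]
      simp
  obtain ⟨j, hj, hjd⟩ := exists_lift_of_isUnit_qMinor K q huniv hr strictMono_id ιY hYunit
  obtain ⟨j', hj', hjd'⟩ := exists_lift_of_isUnit_qMinor K q huniv strictMono_id hc ιZ hZunit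
  obtain ⟨ψ, hψ, -⟩ := exists_lift_of_isUnit_qMinor K q huniv hr hc x hxunit
  have hρj : ∀ g, ρo (j g) =
      Algebra.TensorProduct.map j (.id K G) (Coalgebra.comul (R := K) g) := by
    have h : ρo.comp j = (Algebra.TensorProduct.map j (.id K G)).comp
        (Bialgebra.comulAlgHom K G) :=
      localization_algHom_ext hunit huniv (OqM_algHom_ext fun k l => by simp [hj, hρg, hΔT])
    exact DFunLike.congr_fun h
  have hlamj : ∀ g, lamo (j' g) =
      Algebra.TensorProduct.map (.id K G) j' (Coalgebra.comul (R := K) g) := by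
    have h : lamo.comp j' = (Algebra.TensorProduct.map (.id K G) j').comp
        (Bialgebra.comulAlgHom K G) :=
      localization_algHom_ext hunit huniv (OqM_algHom_ext fun k l => by simp [hj', hlamg, hΔT])
    exact DFunLike.congr_fun h
  have hμψ : ∀ g, μo (ψ g) = Algebra.TensorProduct.map j j' (Coalgebra.comul (R := K) g) := by
    have h : μo.comp ψ = (Algebra.TensorProduct.map j j').comp (Bialgebra.comulAlgHom K G) :=
      localization_algHom_ext hunit huniv
        (OqM_algHom_ext fun k l => by simp [hψ, hμg, hj, hj', hΔT])
    exact DFunLike.congr_fun h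
  ext w
  rw [Set.mem_ofPred_eq, gammaMap_eq_one_tmul_iff ρo lamo
    (localized_coaction_coassoc (T := fun k l => ιG (Xg K q k l)) hΔT hYunit hYuniv hρg)
    (localized_coaction_counit (T := fun k l => ιG (Xg K q k l)) hεT hYunit hYuniv hρg)]
  constructor
  · intro hw
    have hmap : ∀ {R : Type} [Ring R] [Algebra K R] (f : G →ₐ[K] R),
        T.map f * T'.map f = 1 ∧ T'.map f * T.map f = 1 := fun f => by
      rw [← Matrix.map_mul, ← Matrix.map_mul, hT1, hT2]
      simp
    let Y : Matrix (Fin n) (Fin t) Ao := Matrix.of fun i k => ιY (Xg K q i k)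
    let Z : Matrix (Fin t) (Fin n) Zo := Matrix.of fun k c => ιZ (Xg K q k c)
    let U : Subalgebra K Ao := AlgHom.equalizer ρo Algebra.TensorProduct.includeLeft ⊓
      μo.range.comap Algebra.TensorProduct.includeLeft
    let V : Subalgebra K Zo := AlgHom.equalizer lamo Algebra.TensorProduct.includeRight ⊓
      μo.range.comap Algebra.TensorProduct.includeRight
    have hU : ∀ i c, ∑ k, ιY (Xg K q i k) * j (T' k c) ∈ U := by
      intro i c
      constructor
      · have h := mul_right_inv_eq_of_common_factor
          (Y := Y.map ρo) (Y₁ := Y.map fun a => a ⊗ₜ[K] (1 : G))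
          (J := T.map (ρo.comp j)) (J' := T'.map (ρo.comp j))
          (J₁ := T.map (Algebra.TensorProduct.includeLeft.comp j))
          (J₁' := T'.map (Algebra.TensorProduct.includeLeft.comp j))
          (N := T.map fun g => (1 : Ao) ⊗ₜ[K] g)
          (by ext i c; simp [Y, T, Matrix.mul_apply, hρg])
          (by ext i c; simp [T, Matrix.mul_apply, hj, hρg])
          (hmap _).1 (hmap _).2
        have h' := congrFun (congrFun h i) c
        change ρo _ = _ ⊗ₜ 1
        simpa [Matrix.mul_apply, Y, TensorProduct.sum_tmul] using h'
      · have h := mul_right_inv_eq_of_common_factor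
          (Y := (Matrix.of fun i k => x (Xg K q i (colLeft n t htn.le k))).map μo)
          (Y₁ := Y.map fun a => a ⊗ₜ[K] (1 : Zo))
          (J := T.map (μo.comp ψ)) (J' := T'.map (μo.comp ψ))
          (J₁ := T.map (Algebra.TensorProduct.includeLeft.comp j))
          (J₁' := T'.map (Algebra.TensorProduct.includeLeft.comp j))
          (N := T.map fun g => (1 : Ao) ⊗ₜ[K] j' g)
          (by ext i c; simp [Y, T, Matrix.mul_apply, hμg, hj'])
          (by ext i c; simp [T, Matrix.mul_apply, hj, hj', hψ, hμg])
          (hmap _).1 (hmap _).2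
        have h' := congrFun (congrFun h i) c
        refine ⟨∑ k, x (Xg K q i (colLeft n t htn.le k)) * ψ (T' k c), ?_⟩
        change μo _ = _ ⊗ₜ 1
        simpa [Matrix.mul_apply, Y, TensorProduct.sum_tmul] using h'
    have hV : ∀ i c, ∑ k, j' (T' i k) * ιZ (Xg K q k c) ∈ V := by
      intro i c
      constructor
      · have h := mul_left_inv_eq_of_common_factor
          (Z := Z.map lamo) (Z₁ := Z.map fun b => (1 : G) ⊗ₜ[K] b)
          (J := T.map (lamo.comp j')) (J' := T'.map (lamo.comp j'))
          (J₁ := T.map (Algebra.TensorProduct.includeRight.comp j'))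
          (J₁' := T'.map (Algebra.TensorProduct.includeRight.comp j'))
          (N := T.map fun g => g ⊗ₜ[K] (1 : Zo))
          (by ext i c; simp [Z, T, Matrix.mul_apply, hlamg])
          (by ext i c; simp [T, Matrix.mul_apply, hj', hlamg])
          (hmap _).2 (hmap _).1
        have h' := congrFun (congrFun h i) c
        change lamo _ = 1 ⊗ₜ _
        simpa [Matrix.mul_apply, Z, TensorProduct.tmul_sum] using h'
      · have h := mul_left_inv_eq_of_common_factor
          (Z := (Matrix.of fun k c => x (Xg K q (rowTop n t htn.le k) c)).map μo)
          (Z₁ := Z.map fun b => (1 : Ao) ⊗ₜ[K] b)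
          (J := T.map (μo.comp ψ)) (J' := T'.map (μo.comp ψ))
          (J₁ := T.map (Algebra.TensorProduct.includeRight.comp j'))
          (J₁' := T'.map (Algebra.TensorProduct.includeRight.comp j'))
          (N := T.map fun g => j g ⊗ₜ[K] (1 : Zo))
          (by ext i c; simp [Z, T, Matrix.mul_apply, hμg, hj])
          (by ext i c; simp [T, Matrix.mul_apply, hj, hj', hψ, hμg])
          (hmap _).2 (hmap _).1
        have h' := congrFun (congrFun h i) c
        refine ⟨∑ k, ψ (T' i k) * x (Xg K q (rowTop n t htn.le k) c), ?_⟩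
        change μo _ = 1 ⊗ₜ _
        simpa [Matrix.mul_apply, Z, TensorProduct.tmul_sum] using h'
    exact cotensor_le_of_decomposition ρo lamo j j' hρj hlamj μo.range
      (fun g => ⟨ψ g, hμψ g⟩)
      U (fun _ h => h.1) (fun _ h => h.2)
      (localized_left_decomposition K q hq n t htn.le G ιG hunit huniv hΔT Ao ιY hYunit hYuniv
        j hj hjd T' hT1 hT2 U hU)
      V (fun _ h => h.1) (fun _ h => h.2)
      (localized_right_decomposition K q hq n t htn.le G ιG hunit huniv hΔT Zo ιZ hZunit hZuniv
        j' hj' hjd' T' hT1 hT2 V hV) w hw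
  · rintro ⟨y, rfl⟩
    have h : ((Algebra.TensorProduct.assoc K K K Ao G Zo).toAlgHom.comp
        (Algebra.TensorProduct.map ρo (.id K Zo))).comp μo =
        (Algebra.TensorProduct.map (.id K Ao) lamo).comp μo := by
      refine (hXuniv _ (((Algebra.TensorProduct.map (.id K Ao) lamo).comp μo).comp ιX)
        (hxunit.map ((Algebra.TensorProduct.map (.id K Ao) lamo).comp μo))).unique ?_ rfl
      apply RingQuot.ringQuot_ext'
      refine OqM_algHom_ext fun i c => ?_
      change Algebra.TensorProduct.assoc K K K Ao G Zo (Algebra.TensorProduct.map ρo (.id K Zo)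
        (μo (x (Xg K q i c)))) = Algebra.TensorProduct.map (.id K Ao) lamo (μo (x (Xg K q i c)))
      simp only [hμg, map_sum, Algebra.TensorProduct.map_tmul, AlgHom.id_apply, hρg, hlamg,
        TensorProduct.sum_tmul, TensorProduct.tmul_sum, Algebra.TensorProduct.assoc_tmul]
      exact Finset.sum_comm
    exact DFunLike.congr_fun h y

end
end
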